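/- arXiv:2312.00389 — 8 statements merged into one kernel-verified Lean document; each statement's English description precedes it below -/
import Mathlib

section
/- For every real number a > 0, the integral over ℝ of (1 − e^{−a x²})/x² with respect to x equals 2√(πa). -/
open Real MeasureTheory

/-- For every real number `a > 0`, the integral over `ℝ` of `(1 − e^{−a x²})/x²`
equals `2√(πa)`. (The integrand is extended at `x = 0`; the value at a single
point does not affect the Lebesgue integral.) -/
theorem integral_one_sub_exp_neg_mul_sq_div_sq (a : ℝ) (ha : 0 < a) :
    ∫ x : ℝ, (1 - Real.exp (-a * x ^ 2)) / x ^ 2 = 2 * Real.sqrt (π * a) := by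
  have hs : ∀ t ∈ Set.Ioc 0 a, √(π / t) = √π * t ^ (-(1/2) : ℝ) := by
    intro t ht
    rw [Real.sqrt_div pi_pos.le, Real.rpow_neg ht.1.le, ← Real.sqrt_eq_rpow, div_eq_mul_inv]
  have hii : IntervalIntegrable (fun t : ℝ => √π * t ^ (-(1/2) : ℝ)) volume 0 a :=
    (intervalIntegral.intervalIntegrable_rpow' (by norm_num)).const_mul _
  have hint : Integrable (Function.uncurry fun (x t : ℝ) => Real.exp (-t * x ^ 2))
      ((volume : Measure ℝ).prod (volume.restrict (Set.Ioc 0 a))) := by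
    rw [integrable_prod_iff']
    · constructor
      · filter_upwards [ae_restrict_mem measurableSet_Ioc] with t ht
        exact integrable_exp_neg_mul_sq ht.1
      · have h1 := (intervalIntegrable_iff_integrableOn_Ioc_of_le ha.le).1 hii
        refine h1.congr ?_
        filter_upwards [ae_restrict_mem measurableSet_Ioc] with t ht
        simp only [Function.uncurry, Real.norm_eq_abs, Real.abs_exp]
        rw [integral_gaussian, hs t ht]
    · apply Continuous.aestronglyMeasurable
      unfold Function.uncurry
      fun_prop
  have hx : ∀ x : ℝ, x ≠ 0 →
      (1 - Real.exp (-a * x ^ 2)) / x ^ 2 = ∫ t in Set.Ioc 0 a, Real.exp (-t * x ^ 2) := by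
    intro x hx
    rw [← intervalIntegral.integral_of_le ha.le]
    have hd : ∀ t ∈ Set.uIcc 0 a,
        HasDerivAt (fun t : ℝ => -(Real.exp (-t * x ^ 2) / x ^ 2)) (Real.exp (-t * x ^ 2)) t := by
      intro t _
      have := ((((hasDerivAt_id t).neg.mul_const (x ^ 2)).exp).div_const (x ^ 2)).neg
      refine this.congr_deriv ?_
      simp only [Pi.neg_apply, id]
      field_simp
    rw [intervalIntegral.integral_eq_sub_of_hasDerivAt hd
      (Continuous.intervalIntegrable (by fun_prop) _ _)]
    simp
    ring
  have hne : ∀ᵐ x : ℝ, x ≠ 0 := by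
    simp [ae_iff]
  rw [integral_congr_ae (hne.mono hx), integral_integral_swap hint,
    setIntegral_congr_fun measurableSet_Ioc (fun t ht => (integral_gaussian t).trans (hs t ht)),
    ← intervalIntegral.integral_of_le ha.le, intervalIntegral.integral_const_mul,
    integral_rpow (Or.inl (by norm_num)), Real.sqrt_mul pi_pos.le, Real.sqrt_eq_rpow a]
  norm_num
  ring
end

section
/- Let T > 0, ρ ∈ (0,1), χ = ρ(1−ρ), ψ ∈ C²_c(ℝ), H ∈ C^{1,2}_c([0,T]×ℝ), and let μ be defined by μ(t,u) = ∫_ℝ p_t(u−v) ψ(v) dv − χ ∫₀ᵗ ∫_ℝ p'_{t−s}(u−v) ∂_v H(s,v) dv ds for 0 < t ≤ T, with μ(0,·) = ψ. Then for every 0 < t ≤ T one has lim_{M → ∞} (1/M) ∫₀^M u [μ(t,u) − μ(0,u)] du = 0. -/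
open Real MeasureTheory Filter

/-- The one-dimensional heat kernel `p_t(u) = (2πt)^{-1/2} exp(-u²/(2t))`. -/
noncomputable def heatK (t u : ℝ) : ℝ := Real.exp (-(u ^ 2) / (2 * t)) / Real.sqrt (2 * π * t)

/-- The spatial derivative of the heat kernel: `p'_t(u) = -(u/t) p_t(u)`. -/
noncomputable def heatK' (t u : ℝ) : ℝ := -(u / t) * heatK t u

lemma aux_conv (k g : ℝ → ℝ) (R C K u : ℝ) (hR : 0 ≤ R) (hC : ∀ v, |g v| ≤ C)
    (hg : ∀ v, R < |v| → g v = 0) (hk : ∀ w, u - R ≤ w → |k w| ≤ K) (hK : 0 ≤ K) :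
    |∫ v, k (u - v) * g v| ≤ K * C * (2 * R) := by
  have h0 : ∀ v, v ∉ Set.Icc (-R) R → k (u - v) * g v = 0 := by
    intro v hv
    rw [hg v, mul_zero]
    by_contra h
    exact hv (Set.mem_Icc.2 (abs_le.1 (not_lt.1 h)))
  rw [← setIntegral_eq_integral_of_forall_compl_eq_zero h0]
  have h1 := norm_setIntegral_le_of_norm_le_const (μ := volume) (s := Set.Icc (-R) R)
    (f := fun v => k (u - v) * g v) (C := K * C) (by simp) (by
      intro v hv
      rw [Real.norm_eq_abs, abs_mul]
      exact mul_le_mul (hk _ (by linarith [hv.2])) (hC v) (abs_nonneg _) hK)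
  rw [Real.norm_eq_abs] at h1
  refine h1.trans (le_of_eq ?_)
  rw [Real.volume_real_Icc_of_le (by linarith)]
  ring

lemma aux_heat (t w r : ℝ) (ht : 0 < t) (hr : 0 < r) (hw : r ≤ w) :
    |heatK t w| ≤ (2 * t / sqrt (2 * π * t)) / r ^ 2 := by
  have hw0 : 0 < w := hr.trans_le hw
  have hs : 0 < sqrt (2 * π * t) := Real.sqrt_pos.2 (by positivity)
  unfold heatK
  rw [abs_of_nonneg (by positivity)]
  have h1 : exp (-(w ^ 2) / (2 * t)) ≤ 2 * t / r ^ 2 := by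
    rw [neg_div, Real.exp_neg]
    have h2 : r ^ 2 / (2 * t) ≤ exp (w ^ 2 / (2 * t)) := by
      have := Real.add_one_le_exp (w ^ 2 / (2 * t))
      have h3 : r ^ 2 / (2 * t) ≤ w ^ 2 / (2 * t) := by gcongr
      linarith
    calc _ ≤ (r ^ 2 / (2 * t))⁻¹ := inv_anti₀ (by positivity) h2
      _ = _ := by rw [inv_div]
  calc _ ≤ (2 * t / r ^ 2) / sqrt (2 * π * t) := by gcongr
    _ = _ := by ring

lemma aux_heat' (t τ w r : ℝ) (h0 : 0 ≤ τ) (hτ : τ ≤ t) (hr : 1 ≤ r) (hw : r ≤ w) :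
    |heatK' τ w| ≤ (8 * sqrt t) / r ^ 2 := by
  rcases h0.eq_or_lt with h | h
  · subst h; simp [heatK', heatK]; positivity
  have hw0 : 0 < w := by linarith
  have hs : 0 < sqrt τ := Real.sqrt_pos.2 h
  have hs2 : sqrt τ ≤ sqrt (2 * π * τ) := Real.sqrt_le_sqrt (by nlinarith [Real.pi_gt_three])
  unfold heatK' heatK
  rw [abs_mul, abs_neg, abs_of_nonneg (by positivity), abs_of_nonneg (by positivity)]
  have h1 : exp (-(w ^ 2) / (2 * τ)) ≤ 8 * τ ^ 2 / w ^ 4 := by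
    rw [neg_div, Real.exp_neg]
    have h2 : w ^ 4 / (8 * τ ^ 2) ≤ exp (w ^ 2 / (2 * τ)) := by
      have := Real.quadratic_le_exp_of_nonneg (x := w ^ 2 / (2 * τ)) (by positivity)
      have h3 : w ^ 4 / (8 * τ ^ 2) = (w ^ 2 / (2 * τ)) ^ 2 / 2 := by field_simp; norm_num
      have h4 : 0 ≤ w ^ 2 / (2 * τ) := by positivity
      linarith
    calc _ ≤ (w ^ 4 / (8 * τ ^ 2))⁻¹ := inv_anti₀ (by positivity) h2
      _ = _ := by rw [inv_div]
  calc _ ≤ w / τ * ((8 * τ ^ 2 / w ^ 4) / sqrt τ) := by gcongr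
    _ = 8 * sqrt τ / w ^ 3 := by
      have := Real.sq_sqrt h.le
      field_simp
      exact this.symm
    _ ≤ 8 * sqrt t / r ^ 2 := by
      gcongr
      calc r ^ 2 ≤ w ^ 2 := by gcongr
        _ ≤ w ^ 3 := pow_le_pow_right₀ (by linarith) (by norm_num)

lemma aux_cesaro (f : ℝ → ℝ) (hf : Tendsto f atTop (nhds 0)) :
    Tendsto (fun M : ℝ => (1 / M) * ∫ u in (0:ℝ)..M, f u) atTop (nhds 0) := by
  rw [Metric.tendsto_nhds]
  intro ε hε
  have h1 := (Metric.tendsto_nhds.1 hf) (ε / 2) (by positivity)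
  obtain ⟨N, hN⟩ := eventually_atTop.1 h1
  set N' := max N 0
  set A := |∫ u in (0:ℝ)..N', f u|
  filter_upwards [eventually_gt_atTop N', eventually_gt_atTop (2 * A / ε)] with M hM hM2
  have hN0 : 0 ≤ N' := le_max_right _ _
  have hM0 : 0 < M := hN0.trans_lt hM
  have key : |∫ u in (0:ℝ)..M, f u| ≤ A + ε / 2 * M := by
    by_cases hi : IntervalIntegrable f volume 0 M
    · have ha : IntervalIntegrable f volume 0 N' := hi.mono_set (by
        rw [Set.uIcc_of_le hN0, Set.uIcc_of_le hM0.le]; exact Set.Icc_subset_Icc le_rfl hM.le)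
      have hb : IntervalIntegrable f volume N' M := hi.mono_set (by
        rw [Set.uIcc_of_le hM.le, Set.uIcc_of_le hM0.le]; exact Set.Icc_subset_Icc hN0 le_rfl)
      rw [← intervalIntegral.integral_add_adjacent_intervals ha hb]
      have h2 : ‖∫ u in N'..M, f u‖ ≤ ε / 2 * |M - N'| := by
        apply intervalIntegral.norm_integral_le_of_norm_le_const
        intro x hx
        rw [Set.uIoc_of_le hM.le] at hx
        have := hN x ((le_max_left _ _).trans hx.1.le)
        rw [dist_zero_right] at this
        exact this.le
      rw [abs_of_nonneg (by linarith), Real.norm_eq_abs] at h2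
      have h3 := abs_add_le (∫ u in (0:ℝ)..N', f u) (∫ u in N'..M, f u)
      have : ε / 2 * (M - N') ≤ ε / 2 * M := by gcongr; linarith
      linarith
    · rw [intervalIntegral.integral_undef hi, abs_zero]; positivity
  rw [dist_zero_right, Real.norm_eq_abs, abs_mul, abs_of_nonneg (by positivity), one_div,
    inv_mul_lt_iff₀ hM0]
  rw [div_lt_iff₀ hε] at hM2
  linarith

/-- For every `0 < t ≤ T`, `lim_{M → ∞} (1/M) ∫₀^M u [μ(t,u) − μ(0,u)] du = 0`. -/
theorem tendsto_weighted_integral_mu_diff (T ρ χ : ℝ) (hT : 0 < T) (hρ : ρ ∈ Set.Ioo (0:ℝ) 1)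
    (hχ : χ = ρ * (1 - ρ))
    (ψ : ℝ → ℝ) (hψ : ContDiff ℝ 2 ψ) (hψc : HasCompactSupport ψ)
    (H : ℝ → ℝ → ℝ)
    (hH1 : ∀ u, ContDiff ℝ 1 fun t => H t u)
    (hH2 : ∀ t, ContDiff ℝ 2 fun u => H t u)
    (hHt : Continuous fun q : ℝ × ℝ => deriv (fun t => H t q.2) q.1)
    (hHu : Continuous fun q : ℝ × ℝ => deriv (H q.1) q.2)
    (hHuu : Continuous fun q : ℝ × ℝ => deriv (deriv (H q.1)) q.2)
    (hHcont : Continuous fun q : ℝ × ℝ => H q.1 q.2)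
    (hHsupp : HasCompactSupport fun q : ℝ × ℝ => H q.1 q.2)
    (μ : ℝ → ℝ → ℝ)
    (hμ0 : ∀ u, μ 0 u = ψ u)
    (hμ : ∀ t ∈ Set.Ioc (0:ℝ) T, ∀ u, μ t u =
      (∫ v, heatK t (u - v) * ψ v) -
        χ * ∫ s in (0:ℝ)..t, ∫ v, heatK' (t - s) (u - v) * deriv (H s) v) :
    ∀ t ∈ Set.Ioc (0:ℝ) T,
      Filter.Tendsto (fun M : ℝ => (1 / M) * ∫ u in (0:ℝ)..M, u * (μ t u - μ 0 u))
        Filter.atTop (nhds 0) := by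
  intro t ht
  apply aux_cesaro
  obtain ⟨R1, hR1⟩ := hψc.isCompact.isBounded.subset_closedBall 0
  obtain ⟨R2, hR2⟩ := hHsupp.isCompact.isBounded.subset_closedBall 0
  set R := max (max R1 R2) 0
  have hR : 0 ≤ R := le_max_right _ _
  have hψ0 : ∀ v, R < |v| → ψ v = 0 := by
    intro v hv
    by_contra h
    have := hR1 (subset_tsupport _ h)
    rw [mem_closedBall_zero_iff, Real.norm_eq_abs] at this
    exact absurd (this.trans ((le_max_left _ _).trans (le_max_left _ _))) (not_le.2 hv)
  have hH0 : ∀ s v, R < ‖(s, v)‖ → H s v = 0 := by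
    intro s v hv
    by_contra h
    have := hR2 (subset_tsupport (fun q : ℝ × ℝ => H q.1 q.2) (show (s, v) ∈ _ from h))
    rw [mem_closedBall_zero_iff] at this
    exact absurd (this.trans ((le_max_right _ _).trans (le_max_left _ _))) (not_le.2 hv)
  have hD0' : ∀ q : ℝ × ℝ, R < ‖q‖ → deriv (H q.1) q.2 = 0 := by
    intro q hq
    have : H q.1 =ᶠ[nhds q.2] fun _ => 0 := by
      have hc : Continuous fun v : ℝ => ‖(q.1, v)‖ := by fun_prop
      filter_upwards [hc.continuousAt.eventually_const_lt (show R < ‖(q.1, q.2)‖ from hq)] with v hv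
      exact hH0 _ _ hv
    rw [this.deriv_eq]; simp
  have hD0 : ∀ s v, R < |v| → deriv (H s) v = 0 := by
    intro s v hv
    exact hD0' (s, v) (hv.trans_le (by simpa using norm_snd_le (s, v)))
  have hDc : HasCompactSupport fun q : ℝ × ℝ => deriv (H q.1) q.2 := by
    apply HasCompactSupport.intro (isCompact_closedBall 0 R)
    intro q hq
    apply hD0'
    simpa using hq
  obtain ⟨C1, hC1⟩ := hψc.exists_bound_of_continuous hψ.continuous
  obtain ⟨C2, hC2⟩ := hDc.exists_bound_of_continuous hHu
  have ht0 : 0 < t := ht.1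
  set A := 2 * t / sqrt (2 * π * t)
  set B := 8 * sqrt t
  have hA : 0 ≤ A := by positivity
  have hB : 0 ≤ B := by positivity
  set D := A * C1 * (2 * R) + |χ| * (B * C2 * (2 * R) * t)
  have main : ∀ u, 2 * R + 2 ≤ u → ‖u * (μ t u - μ 0 u)‖ ≤ 4 * D * u⁻¹ := by
    intro u hu
    have hr : 1 ≤ u - R := by linarith
    have e1 := aux_conv (heatK t) ψ R C1 (A / (u - R) ^ 2) u hR hC1 hψ0
      (fun w hw => aux_heat t w (u - R) ht0 (by linarith) hw) (by positivity)
    have e2 : ‖∫ s in (0:ℝ)..t, ∫ v, heatK' (t - s) (u - v) * deriv (H s) v‖ ≤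
        (B / (u - R) ^ 2 * C2 * (2 * R)) * |t - 0| := by
      apply intervalIntegral.norm_integral_le_of_norm_le_const
      intro s hs
      rw [Set.uIoc_of_le ht0.le] at hs
      exact aux_conv (heatK' (t - s)) (deriv (H s)) R C2 (B / (u - R) ^ 2) u hR
        (fun v => hC2 (s, v)) (hD0 s)
        (fun w hw => aux_heat' t (t - s) w (u - R) (by linarith [hs.2]) (by linarith [hs.1]) hr hw)
        (by positivity)
    rw [sub_zero, abs_of_pos ht0, Real.norm_eq_abs] at e2
    rw [hμ0, hψ0 u (by rw [abs_of_nonneg] <;> linarith), sub_zero, hμ t ht, Real.norm_eq_abs,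
      abs_mul, abs_of_nonneg (by linarith : (0:ℝ) ≤ u)]
    have e3 := abs_sub (∫ v, heatK t (u - v) * ψ v)
      (χ * ∫ s in (0:ℝ)..t, ∫ v, heatK' (t - s) (u - v) * deriv (H s) v)
    rw [abs_mul χ] at e3
    have e4 := mul_le_mul_of_nonneg_left e2 (abs_nonneg χ)
    have e5 : |(∫ v, heatK t (u - v) * ψ v) -
      χ * ∫ s in (0:ℝ)..t, ∫ v, heatK' (t - s) (u - v) * deriv (H s) v| ≤ D / (u - R) ^ 2 := by
      refine (e3.trans (add_le_add e1 e4)).trans (le_of_eq ?_)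
      simp only [D]; ring
    have hu0 : 0 < u := by linarith
    have hr0 : 0 < u - R := by linarith
    have hD : 0 ≤ D := by
      by_contra h
      have := (abs_nonneg _).trans e5
      exact absurd this (not_le.2 (div_neg_of_neg_of_pos (not_le.1 h) (by positivity)))
    calc _ ≤ u * (D / (u - R) ^ 2) := by gcongr
      _ ≤ u * (D / (u / 2) ^ 2) := by gcongr; linarith
      _ = _ := by field_simp; norm_num
  refine squeeze_zero_norm' (eventually_atTop.2 ⟨_, main⟩) ?_
  simpa using tendsto_inv_atTop_zero.const_mul (4 * D)
end

section
/- Let T > 0, ρ ∈ (0,1), χ = ρ(1−ρ), ψ ∈ C²_c(ℝ), H ∈ C^{1,2}_c([0,T]×ℝ), and let μ be defined by μ(t,u) = ∫_ℝ p_t(u−v) ψ(v) dv − χ ∫₀ᵗ ∫_ℝ p'_{t−s}(u−v) ∂_v H(s,v) dv ds for 0 < t ≤ T, with μ(0,·) = ψ. Define J(t,u) = −(1/2) ∂_u μ(t,u) + χ ∂_u H(t,u) and K(t,u) = ∫₀ᵗ J(s,u) ds. Then (1/2)∫_ℝ ψ(u)² du + (χ²/2)∫₀ᵀ∫_ℝ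 (∂_u H(t,u))² du dt = (1/2)∫₀ᵀ∫_ℝ (∂_t K(t,u))² du dt + (1/4)∫_ℝ (∂_u K(T,u))² du + (1/8)∫₀ᵀ∫_ℝ (ψ'(u) − ∂_u² K(t,u))² du dt + (1/2)∫_ℝ [ψ(u)² − ψ(u) ∂_u K(T,u)] du. -/
open Real MeasureTheory

open Filter Topology ProbabilityTheory Set


structure Src (F : ℝ → ℝ → ℝ) (C : ℝ) : Prop where
  cont : Continuous (fun q : ℝ × ℝ => F q.1 q.2)
  nn : 0 ≤ C
  bd : ∀ s u, |F s u| ≤ C * (1 + u ^ 2)⁻¹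

lemma w_pos (u : ℝ) : 0 < (1 + u ^ 2)⁻¹ := by positivity
lemma w_le (u : ℝ) : (1 + u ^ 2)⁻¹ ≤ 1 := inv_le_one_of_one_le₀ (by nlinarith [sq_nonneg u])

lemma w_shift (u x : ℝ) : (1 + (u + x) ^ 2)⁻¹ ≤ 2 * (1 + x ^ 2) * (1 + u ^ 2)⁻¹ := by
  rw [inv_eq_one_div, inv_eq_one_div, mul_one_div, div_le_div_iff₀ (by positivity) (by positivity)]
  nlinarith [sq_nonneg (u + 2 * x), sq_nonneg (x * (u + x))]

namespace Src
variable {F G : ℝ → ℝ → ℝ} {C D : ℝ}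

lemma cont2 (h : Src F C) (s : ℝ) : Continuous (F s) :=
  h.cont.comp (by fun_prop : Continuous fun u : ℝ => (s, u))

lemma cont1 (h : Src F C) (u : ℝ) : Continuous (fun s => F s u) :=
  h.cont.comp (by fun_prop : Continuous fun s : ℝ => (s, u))

lemma bd1 (h : Src F C) (s u : ℝ) : |F s u| ≤ C :=
  (h.bd s u).trans (by nlinarith [h.nn, w_le u])

lemma add (h : Src F C) (k : Src G D) : Src (fun s u => F s u + G s u) (C + D) :=
  ⟨h.cont.add k.cont, add_nonneg h.nn k.nn, fun s u => by
    have := h.bd s u; have := k.bd s u; have := abs_add_le (F s u) (G s u); nlinarith⟩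

lemma cmul (c : ℝ) (h : Src F C) : Src (fun s u => c * F s u) (|c| * C) :=
  ⟨continuous_const.mul h.cont, mul_nonneg (abs_nonneg _) h.nn, fun s u => by
    rw [abs_mul, mul_assoc]; exact mul_le_mul_of_nonneg_left (h.bd s u) (abs_nonneg _)⟩

lemma sub (h : Src F C) (k : Src G D) : Src (fun s u => F s u - G s u) (C + D) :=
  ⟨h.cont.sub k.cont, add_nonneg h.nn k.nn, fun s u => by
    have := h.bd s u; have := k.bd s u; have := abs_sub (F s u) (G s u); nlinarith⟩

lemma mul (h : Src F C) (k : Src G D) : Src (fun s u => F s u * G s u) (C * D) :=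
  ⟨h.cont.mul k.cont, mul_nonneg h.nn k.nn, fun s u => by
    rw [abs_mul]
    calc |F s u| * |G s u| ≤ (C * (1 + u ^ 2)⁻¹) * D :=
          mul_le_mul (h.bd s u) (k.bd1 s u) (abs_nonneg _) (mul_nonneg h.nn (w_pos u).le)
      _ = _ := by ring⟩

lemma sq (h : Src F C) : Src (fun s u => F s u ^ 2) (C * C) := by
  simpa [pow_two] using h.mul h

lemma shift (h : Src F C) (x : ℝ) : Src (fun s u => F s (u + x)) (C * (2 * (1 + x ^ 2))) :=
  ⟨h.cont.comp (by fun_prop : Continuous fun q : ℝ × ℝ => (q.1, q.2 + x)),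
    mul_nonneg h.nn (by positivity), fun s u => (h.bd s (u + x)).trans (by
      rw [mul_assoc]; exact mul_le_mul_of_nonneg_left (w_shift u x) h.nn)⟩

lemma integrable (h : Src F C) (s : ℝ) : Integrable (F s) :=
  (integrable_inv_one_add_sq.const_mul C).mono' (h.cont2 s).aestronglyMeasurable
    (ae_of_all _ fun u => h.bd s u)

lemma cont_int (h : Src F C) : Continuous fun s => ∫ u, F s u :=
  continuous_of_dominated (fun s => (h.cont2 s).aestronglyMeasurable)
    (fun s => ae_of_all _ fun u => h.bd s u) (integrable_inv_one_add_sq.const_mul C)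
    (ae_of_all _ fun u => h.cont1 u)

lemma swap (h : Src F C) (a b : ℝ) : ∫ s in a..b, ∫ u, F s u = ∫ u, ∫ s in a..b, F s u := by
  apply intervalIntegral_integral_swap
  have : IsFiniteMeasure (volume.restrict (Set.uIoc a b)) := ⟨by simp [uIoc]⟩
  have : Integrable (fun q : ℝ × ℝ => C * (1 + q.2 ^ 2)⁻¹)
      ((volume.restrict (Set.uIoc a b)).prod volume) := by
    have := (integrable_const (1:ℝ) (μ := volume.restrict (Set.uIoc a b))).mul_prod
      (integrable_inv_one_add_sq.const_mul C)
    simpa using this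
  exact this.mono' h.cont.aestronglyMeasurable (ae_of_all _ fun q => h.bd q.1 q.2)

end Src

lemma swap_interval {F : ℝ → ℝ → ℝ} (h : Continuous (fun q : ℝ × ℝ => F q.1 q.2)) (a b c d : ℝ) :
    ∫ x in a..b, ∫ y in c..d, F x y = ∫ y in c..d, ∫ x in a..b, F x y := by
  apply intervalIntegral_intervalIntegral_swap
  have : IntegrableOn (Function.uncurry F) (uIcc a b ×ˢ uIcc c d) :=
    h.continuousOn.integrableOn_compact (isCompact_uIcc.prod isCompact_uIcc)
  exact this.mono_set (Set.prod_mono uIoc_subset_uIcc uIoc_subset_uIcc)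

lemma triangle {q : ℝ → ℝ → ℝ} (h : Continuous (fun p : ℝ × ℝ => q p.1 p.2)) (t : ℝ) (ht : 0 ≤ t) :
    ∫ s in (0:ℝ)..t, ∫ r in s..t, q r s = ∫ r in (0:ℝ)..t, ∫ s in (0:ℝ)..r, q r s := by
  have key := intervalIntegral_intervalIntegral_swap (F := fun s r => if s < r then q r s else 0)
    (a := 0) (b := t) (c := 0) (d := t) (by
      have : IntegrableOn (fun p : ℝ × ℝ => q p.2 p.1) (uIcc 0 t ×ˢ uIcc 0 t) :=
        (h.comp continuous_swap).continuousOn.integrableOn_compact (isCompact_uIcc.prod isCompact_uIcc)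
      have := this.mono_set (Set.prod_mono uIoc_subset_uIcc uIoc_subset_uIcc)
      have hm : MeasurableSet {p : ℝ × ℝ | p.1 < p.2} := measurableSet_lt measurable_fst measurable_snd
      have := Integrable.indicator this hm
      refine this.congr (ae_of_all _ fun p => ?_)
      simp [Set.indicator, Function.uncurry])
  have hi : ∀ r a b : ℝ, IntervalIntegrable (fun s => if s < r then q r s else 0) volume a b := by
    intro r a b
    have : IntervalIntegrable (fun s => q r s) volume a b :=
      (h.comp (by fun_prop : Continuous fun u : ℝ => (r, u))).intervalIntegrable a b
    rw [intervalIntegrable_iff] at this ⊢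
    refine (Integrable.indicator this (measurableSet_Iio (a := r))).congr (ae_of_all _ fun p => ?_)
    simp [Set.indicator]
  have hi' : ∀ s a b : ℝ, IntervalIntegrable (fun r => if s < r then q r s else 0) volume a b := by
    intro s a b
    have : IntervalIntegrable (fun r => q r s) volume a b :=
      (h.comp (by fun_prop : Continuous fun u : ℝ => (u, s))).intervalIntegrable a b
    rw [intervalIntegrable_iff] at this ⊢
    refine (Integrable.indicator this (measurableSet_Ioi (a := s))).congr (ae_of_all _ fun p => ?_)
    simp [Set.indicator]
  rw [intervalIntegral.integral_congr_Ioo_of_le ht (g := fun s => ∫ r in (0:ℝ)..t, if s < r then q r s else 0), key]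
  · refine intervalIntegral.integral_congr_Ioo_of_le ht fun r hr => ?_
    show _ = ∫ s in (0:ℝ)..r, q r s
    rw [← intervalIntegral.integral_add_adjacent_intervals (hi r 0 r) (hi r r t)]
    rw [intervalIntegral.integral_congr_Ioo_of_le hr.1.le (g := fun s => q r s) fun s hs => by simp [hs.2],
      intervalIntegral.integral_congr_Ioo_of_le hr.2.le (g := fun s => 0) fun s hs => by
        simp only [if_neg (not_lt.2 hs.1.le)]]
    simp
  · intro s hs
    dsimp only
    rw [← intervalIntegral.integral_add_adjacent_intervals (hi' s 0 s) (hi' s s t)]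
    rw [intervalIntegral.integral_congr_Ioo_of_le hs.1.le (g := fun s => 0) fun r hr => by
        simp only [if_neg (not_lt.2 hr.2.le)],
      intervalIntegral.integral_congr_Ioo_of_le hs.2.le
        (f := fun r => if s < r then q r s else 0) (g := fun r => q r s) fun r hr => by simp [hr.1]]
    simp

noncomputable def cw : ℝ := 2 * ∫ z, (1 + z ^ 2) ^ 2 ∂(gaussianReal 0 1)

lemma int_w4 : Integrable (fun z : ℝ => (1 + z ^ 2) ^ 2) (gaussianReal 0 1) := by
  have h4 : Integrable (fun z : ℝ => z ^ 4) (gaussianReal 0 1) := by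
    have := (memLp_id_gaussianReal (μ := 0) (v := 1) 4).integrable_norm_pow (by norm_num)
    simpa [abs_pow, Even.pow_abs (by decide : Even 4)] using this
  have h2 : Integrable (fun z : ℝ => z ^ 2) (gaussianReal 0 1) := by
    have := (memLp_id_gaussianReal (μ := 0) (v := 1) 2).integrable_norm_pow (by norm_num)
    simpa using this
  have := ((integrable_const (1:ℝ) (μ := (gaussianReal 0 1))).add (h2.const_mul 2)).add h4
  refine this.congr (ae_of_all _ fun z => ?_)
  simp; ring

lemma cw_nonneg : 0 ≤ cw := mul_nonneg zero_le_two (integral_nonneg fun z => by positivity)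

noncomputable def Aop (p : ℝ → ℝ) (F : ℝ → ℝ → ℝ) (s σ u : ℝ) : ℝ := ∫ z, p z * F s (u + σ * z) ∂(gaussianReal 0 1)

structure Wt (p : ℝ → ℝ) : Prop where
  cont : Continuous p
  bd : ∀ z, |p z| ≤ 1 + z ^ 2

lemma wt_one : Wt (fun _ => 1) := ⟨continuous_const, fun z => by simp; positivity⟩
lemma wt_id : Wt (fun z => z) := ⟨continuous_id, fun z => by
  rw [abs_le]; constructor <;> nlinarith [sq_nonneg (z - 1), sq_nonneg (z + 1)]⟩

lemma Aop_ptbd {p : ℝ → ℝ} (hp : Wt p) {F : ℝ → ℝ → ℝ} {C : ℝ} (h : Src F C) (s σ u z : ℝ) :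
    |p z * F s (u + σ * z)| ≤ C * (2 * (1 + σ ^ 2)) * (1 + u ^ 2)⁻¹ * (1 + z ^ 2) ^ 2 := by
  rw [abs_mul]
  have h1 : |F s (u + σ * z)| ≤ C * (2 * (1 + σ ^ 2) * (1 + z ^ 2) * (1 + u ^ 2)⁻¹) := by
    refine (h.bd _ _).trans (mul_le_mul_of_nonneg_left ((w_shift _ _).trans ?_) h.nn)
    refine mul_le_mul_of_nonneg_right ?_ (w_pos u).le
    nlinarith [sq_nonneg σ, sq_nonneg z]
  calc |p z| * |F s (u + σ * z)| ≤ (1 + z ^ 2) * (C * (2 * (1 + σ ^ 2) * (1 + z ^ 2) * (1 + u ^ 2)⁻¹)) :=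
        mul_le_mul (hp.bd z) h1 (abs_nonneg _) (by positivity)
    _ = _ := by ring

lemma Aop_ptbd' {p : ℝ → ℝ} (hp : Wt p) {F : ℝ → ℝ → ℝ} {C : ℝ} (h : Src F C) (s σ u z : ℝ) :
    |p z * F s (u + σ * z)| ≤ C * (1 + z ^ 2) ^ 2 := by
  rw [abs_mul]
  calc |p z| * |F s (u + σ * z)| ≤ (1 + z ^ 2) * C :=
        mul_le_mul (hp.bd z) (h.bd1 _ _) (abs_nonneg _) (by positivity)
    _ ≤ _ := by nlinarith [mul_nonneg h.nn (sq_nonneg z), mul_nonneg h.nn (sq_nonneg (z ^ 2))]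

lemma Aop_meas {p : ℝ → ℝ} (hp : Wt p) {F : ℝ → ℝ → ℝ} {C : ℝ} (h : Src F C) (s σ u : ℝ) :
    AEStronglyMeasurable (fun z => p z * F s (u + σ * z)) (gaussianReal 0 1) :=
  (hp.cont.mul ((h.cont2 s).comp (by fun_prop))).aestronglyMeasurable

lemma Aop_intble {p : ℝ → ℝ} (hp : Wt p) {F : ℝ → ℝ → ℝ} {C : ℝ} (h : Src F C) (s σ u : ℝ) :
    Integrable (fun z => p z * F s (u + σ * z)) (gaussianReal 0 1) :=
  (int_w4.const_mul C).mono' (Aop_meas hp h s σ u) (ae_of_all _ fun z => Aop_ptbd' hp h s σ u z)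

lemma Aop_bd {p : ℝ → ℝ} (hp : Wt p) {F : ℝ → ℝ → ℝ} {C : ℝ} (h : Src F C) (s σ u : ℝ) :
    |Aop p F s σ u| ≤ C * cw * (1 + σ ^ 2) * (1 + u ^ 2)⁻¹ := by
  have := norm_integral_le_of_norm_le (μ := (gaussianReal 0 1)) (f := fun z => p z * F s (u + σ * z))
    (int_w4.const_mul (C * (2 * (1 + σ ^ 2)) * (1 + u ^ 2)⁻¹))
    (ae_of_all _ fun z => Aop_ptbd hp h s σ u z)
  refine this.trans (le_of_eq ?_)
  rw [integral_const_mul, cw]; ring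

lemma Aop_cont {p : ℝ → ℝ} (hp : Wt p) {F : ℝ → ℝ → ℝ} {C : ℝ} (h : Src F C) :
    Continuous (fun x : ℝ × ℝ × ℝ => Aop p F x.1 x.2.1 x.2.2) := by
  refine continuous_of_dominated (fun x => Aop_meas hp h _ _ _)
    (fun x => ae_of_all _ fun z => Aop_ptbd' hp h _ _ _ z) (int_w4.const_mul C)
    (ae_of_all _ fun z => ?_)
  exact continuous_const.mul (h.cont.comp
    (by fun_prop : Continuous fun x : ℝ × ℝ × ℝ => (x.1, x.2.2 + x.2.1 * z)))

lemma Aop_zero (F : ℝ → ℝ → ℝ) (s u : ℝ) : Aop (fun _ => 1) F s 0 u = F s u := by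
  simp [Aop]

/-- Derivative in `u`. -/
lemma Aop_deriv {F F1 : ℝ → ℝ → ℝ} {C C1 : ℝ} (h : Src F C) (h1 : Src F1 C1)
    (hd : ∀ s u, HasDerivAt (F s) (F1 s u) u) (s σ u : ℝ) :
    HasDerivAt (fun u => Aop (fun _ => 1) F s σ u) (Aop (fun _ => 1) F1 s σ u) u := by
  refine (hasDerivAt_integral_of_dominated_loc_of_deriv_le (μ := (gaussianReal 0 1)) (s := univ) (bound := fun z => C1 * (1 + z ^ 2) ^ 2)
    (F := fun u z => 1 * F s (u + σ * z)) (F' := fun u z => 1 * F1 s (u + σ * z))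
    univ_mem (Eventually.of_forall fun u => Aop_meas wt_one h s σ u) (Aop_intble wt_one h s σ u)
    (Aop_meas wt_one h1 s σ u) (ae_of_all _ fun z x _ => Aop_ptbd' wt_one h1 s σ x z)
    (int_w4.const_mul C1) (ae_of_all _ fun z x _ => ?_)).2
  exact ((hd s (x + σ * z)).comp_add_const x (σ * z)).const_mul 1

/-- Derivative in `σ`. -/
lemma Aop_deriv_sigma {F F1 : ℝ → ℝ → ℝ} {C C1 : ℝ} (h : Src F C) (h1 : Src F1 C1)
    (hd : ∀ s u, HasDerivAt (F s) (F1 s u) u) (s σ u : ℝ) :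
    HasDerivAt (fun σ => Aop (fun _ => 1) F s σ u) (Aop (fun z => z) F1 s σ u) σ := by
  refine (hasDerivAt_integral_of_dominated_loc_of_deriv_le (μ := (gaussianReal 0 1)) (s := univ) (bound := fun z => C1 * (1 + z ^ 2) ^ 2)
    (F := fun σ z => 1 * F s (u + σ * z)) (F' := fun σ z => z * F1 s (u + σ * z))
    univ_mem (Eventually.of_forall fun x => Aop_meas wt_one h s x u) (Aop_intble wt_one h s σ u)
    (Aop_meas wt_id h1 s σ u) (ae_of_all _ fun z x _ => Aop_ptbd' wt_id h1 s x u z)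
    (int_w4.const_mul C1) (ae_of_all _ fun z x _ => ?_)).2
  have : HasDerivAt (fun x => u + x * z) z x := by
    simpa using ((hasDerivAt_id x).mul_const z).const_add u
  have := ((hd s (u + x * z)).comp x this).const_mul 1
  refine this.congr_deriv (by ring)

lemma gpdf_deriv (z : ℝ) : HasDerivAt (gaussianPDFReal 0 1) (-z * gaussianPDFReal 0 1 z) z := by
  rw [gaussianPDFReal_def]
  have : HasDerivAt (fun x : ℝ => -(x - 0) ^ 2 / (2 * ((1 : NNReal) : ℝ))) (-z) z := by
    have := (((hasDerivAt_id z).sub_const 0).pow 2).neg.div_const (2 * ((1 : NNReal) : ℝ))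
    refine this.congr_deriv ?_
    simp
    ring
  refine (this.exp.const_mul _).congr_deriv ?_
  ring

lemma int_gauss {f : ℝ → ℝ} (hf : Integrable f (gaussianReal 0 1)) : Integrable (fun z => gaussianPDFReal 0 1 z * f z) := by
  rw [gaussianReal_of_var_ne_zero _ one_ne_zero,
    integrable_withDensity_iff_integrable_smul' (measurable_gaussianPDF _ _)
      (ae_of_all _ fun _ => gaussianPDF_lt_top)] at hf
  simpa using hf

/-- Gaussian integration by parts. -/
lemma Aop_ibp {F F1 : ℝ → ℝ → ℝ} {C C1 : ℝ} (h : Src F C) (h1 : Src F1 C1)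
    (hd : ∀ s u, HasDerivAt (F s) (F1 s u) u) (s σ u : ℝ) :
    Aop (fun z => z) F s σ u = σ * Aop (fun _ => 1) F1 s σ u := by
  have key := integral_eq_zero_of_hasDerivAt_of_integrable
    (f := fun z => gaussianPDFReal 0 1 z * (1 * F s (u + σ * z)))
    (f' := fun z => σ * (gaussianPDFReal 0 1 z * (1 * F1 s (u + σ * z)))
       - gaussianPDFReal 0 1 z * (z * F s (u + σ * z))) (fun z => by
      have : HasDerivAt (fun x => u + σ * x) σ z := by
        simpa using ((hasDerivAt_id z).const_mul σ).const_add u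
      have := (gpdf_deriv z).mul (((hd s (u + σ * z)).comp z this).const_mul 1)
      refine this.congr_deriv (by simp; ring))
    (((int_gauss (Aop_intble wt_one h1 s σ u)).const_mul σ).sub
      (int_gauss (Aop_intble wt_id h s σ u))) (int_gauss (Aop_intble wt_one h s σ u))
  rw [integral_sub ((int_gauss (Aop_intble wt_one h1 s σ u)).const_mul σ)
      (int_gauss (Aop_intble wt_id h s σ u)), integral_const_mul] at key
  simp only [Aop, integral_gaussianReal_eq_integral_smul (one_ne_zero), smul_eq_mul]
  linarith

/-- The heat equation in integrated form. -/
lemma Aop_heat {F F1 F2 : ℝ → ℝ → ℝ} {C C1 C2 : ℝ} (h : Src F C) (h1 : Src F1 C1) (h2 : Src F2 C2)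
    (hd : ∀ s u, HasDerivAt (F s) (F1 s u) u) (hd1 : ∀ s u, HasDerivAt (F1 s) (F2 s u) u)
    (s u a t : ℝ) (hat : a ≤ t) :
    Aop (fun _ => 1) F s (√(t - a)) u - F s u
      = ∫ r in a..t, (1/2) * Aop (fun _ => 1) F2 s (√(r - a)) u := by
  rw [intervalIntegral.integral_eq_sub_of_hasDerivAt_of_le hat (f := fun r => Aop (fun _ => 1) F s (√(r - a)) u)]
  · simp [Aop_zero]
  · exact ((Aop_cont wt_one h).comp
      (by fun_prop : Continuous fun r : ℝ => (s, √(r - a), u))).continuousOn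
  · intro r hr
    have hra : 0 < r - a := sub_pos.2 hr.1
    have e1 : HasDerivAt (fun r => √(r - a)) (1 / (2 * √(r - a))) r :=
      ((hasDerivAt_id r).sub_const a).sqrt hra.ne'
    have := (Aop_deriv_sigma h h1 hd s (√(r - a)) u).comp r e1
    refine this.congr_deriv ?_
    rw [Aop_ibp h1 h2 hd1]
    have : √(r - a) ≠ 0 := (Real.sqrt_pos.2 hra).ne'
    field_simp
  · apply Continuous.intervalIntegrable
    exact continuous_const.mul ((Aop_cont wt_one h2).comp
      (by fun_prop : Continuous fun r : ℝ => (s, √(r - a), u)))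

lemma heat_eq_gauss (q : ℝ → ℝ) (t u : ℝ) (ht : 0 < t) :
    ∫ v, heatK t (u - v) * q v = ∫ z, q (u + √t * z) ∂(gaussianReal 0 1) := by
  have e : ∀ z, q (u + √t * z) = (fun x => q (x + u)) (√t * z) := fun z => by simp [add_comm]
  have hs : 0 < √t := Real.sqrt_pos.2 ht
  have hst : √t ^ 2 = t := Real.sq_sqrt ht.le
  rw [integral_gaussianReal_eq_integral_smul one_ne_zero]
  rw [← integral_add_right_eq_self (μ := volume) (fun v => heatK t (u - v) * q v) u]
  have := Measure.integral_comp_mul_left (fun v => heatK t (u - (v + u)) * q (v + u)) (√t)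
  have h3 : ∫ v, heatK t (u - (v + u)) * q (v + u) = √t * ∫ x, heatK t (u - (√t * x + u)) * q (√t * x + u) := by
    rw [this, abs_of_pos (inv_pos.2 hs), smul_eq_mul, ← mul_assoc, mul_inv_cancel₀ hs.ne', one_mul]
  rw [h3, ← integral_const_mul]
  refine integral_congr_ae (ae_of_all _ fun z => ?_)
  simp only [heatK, gaussianPDFReal, smul_eq_mul, add_comm u]
  rw [← mul_assoc]
  congr 1
  have : (u - (√t * z + u)) ^ 2 = t * z ^ 2 := by rw [← hst]; simp; ring
  rw [this, Real.sqrt_mul (by positivity)]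
  have : -(t * z ^ 2) / (2 * t) = -z ^ 2 / 2 := by field_simp
  rw [this]
  simp
  field_simp

lemma heat_A (ψ : ℝ → ℝ) (t u : ℝ) (ht : 0 < t) :
    ∫ v, heatK t (u - v) * ψ v = Aop (fun _ => 1) (fun _ => ψ) 0 (√t) u := by
  rw [heat_eq_gauss _ _ _ ht]; simp [Aop]

lemma heat_A' {F F1 : ℝ → ℝ → ℝ} {C C1 : ℝ} (h : Src F C) (h1 : Src F1 C1)
    (hd : ∀ s u, HasDerivAt (F s) (F1 s u) u) (s t u : ℝ) (ht : 0 < t) :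
    ∫ v, heatK' t (u - v) * F s v = Aop (fun _ => 1) F1 s (√t) u := by
  have hs : 0 < √t := Real.sqrt_pos.2 ht
  have e : ∀ v, heatK' t (u - v) * F s v = heatK t (u - v) * (-((u - v) / t) * F s v) := fun v => by
    rw [heatK']; ring
  simp_rw [e]
  rw [heat_eq_gauss _ _ _ ht]
  have := Aop_ibp h h1 hd s (√t) u
  rw [mul_comm, ← div_eq_iff hs.ne'] at this
  rw [← this, Aop, ← integral_div]
  refine integral_congr_ae (ae_of_all _ fun z => ?_)
  have hst : √t * √t = t := Real.mul_self_sqrt ht.le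
  show -((u - (u + √t * z)) / t) * F s (u + √t * z) = z * F s (u + √t * z) / √t
  have : -((u - (u + √t * z)) / t) = z / √t := by
    rw [sub_add_cancel_left, neg_div, neg_neg, div_eq_div_iff ht.ne' hs.ne', mul_right_comm, hst]; ring
  rw [this]; ring

noncomputable def cl (T t : ℝ) : ℝ := max 0 (min t T)

lemma cl_cont (T : ℝ) : Continuous (cl T) := by unfold cl; fun_prop
lemma cl_nonneg (T t : ℝ) : 0 ≤ cl T t := le_max_left _ _
lemma cl_le {T : ℝ} (hT : 0 ≤ T) (t : ℝ) : cl T t ≤ T := max_le hT (min_le_right _ _)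
lemma cl_eq {T t : ℝ} (h0 : 0 ≤ t) (h1 : t ≤ T) : cl T t = t := by simp [cl, h0, h1]

noncomputable def Pop (T : ℝ) (ψ : ℝ → ℝ) (t u : ℝ) : ℝ := Aop (fun _ => 1) (fun _ => ψ) 0 (√(cl T t)) u
noncomputable def Dop (T : ℝ) (F : ℝ → ℝ → ℝ) (t u : ℝ) : ℝ :=
  ∫ s in (0:ℝ)..cl T t, Aop (fun _ => 1) F s (√(cl T t - s)) u
noncomputable def D1op (T : ℝ) (F : ℝ → ℝ → ℝ) (t u : ℝ) : ℝ :=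
  ∫ σ in (0:ℝ)..√(cl T t), 2 * Aop (fun z => z) F (cl T t - σ ^ 2) σ u

section ops
variable {T : ℝ}

lemma Pop_src (hT : 0 ≤ T) {ψ : ℝ → ℝ} {C : ℝ} (h : Src (fun _ => ψ) C) : Src (Pop T ψ) (C * cw * (1 + T)) where
  cont := by
    have := cl_cont T
    exact (Aop_cont wt_one h).comp (by fun_prop : Continuous fun q : ℝ × ℝ => ((0:ℝ), √(cl T q.1), q.2))
  nn := mul_nonneg (mul_nonneg h.nn cw_nonneg) (by linarith)
  bd s u := by
    refine (Aop_bd wt_one h _ _ _).trans ?_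
    rw [Real.sq_sqrt (cl_nonneg _ _)]
    refine mul_le_mul_of_nonneg_right (mul_le_mul_of_nonneg_left ?_ (mul_nonneg h.nn cw_nonneg)) (w_pos u).le
    linarith [cl_le hT s]

lemma Dop_src (hT : 0 ≤ T) {F : ℝ → ℝ → ℝ} {C : ℝ} (h : Src F C) : Src (Dop T F) (C * cw * (1 + T) * T) where
  cont := by
    have := cl_cont T
    refine intervalIntegral.continuous_parametric_intervalIntegral_of_continuous
      (f := fun (q : ℝ × ℝ) s => Aop (fun _ => 1) F s (√(cl T q.1 - s)) q.2) ?_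
      (s := fun q => cl T q.1) (by fun_prop)
    exact (Aop_cont wt_one h).comp
      (by fun_prop : Continuous fun x : (ℝ × ℝ) × ℝ => (x.2, √(cl T x.1.1 - x.2), x.1.2))
  nn := mul_nonneg (mul_nonneg (mul_nonneg h.nn cw_nonneg) (by linarith)) hT
  bd t u := by
    have hc := cl_nonneg T t
    have hc' := cl_le hT t
    have hX : 0 ≤ C * cw * (1 + T) * (1 + u ^ 2)⁻¹ :=
      mul_nonneg (mul_nonneg (mul_nonneg h.nn cw_nonneg) (by linarith)) (w_pos u).le
    have := intervalIntegral.norm_integral_le_of_norm_le_const (a := 0) (b := cl T t)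
      (f := fun s => Aop (fun _ => 1) F s (√(cl T t - s)) u) (C := C * cw * (1 + T) * (1 + u ^ 2)⁻¹)
      (fun s hs => by
        rw [uIoc_of_le hc] at hs
        refine (Aop_bd wt_one h _ _ _).trans ?_
        rw [Real.sq_sqrt (sub_nonneg.2 hs.2)]
        refine mul_le_mul_of_nonneg_right
          (mul_le_mul_of_nonneg_left ?_ (mul_nonneg h.nn cw_nonneg)) (w_pos u).le
        linarith [hs.1])
    refine this.trans ?_
    rw [sub_zero, abs_of_nonneg hc]
    nlinarith [mul_le_mul_of_nonneg_left hc' hX]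

lemma D1op_src (hT : 0 ≤ T) {F : ℝ → ℝ → ℝ} {C : ℝ} (h : Src F C) : Src (D1op T F) (C * cw * (1 + T) * (2 * √T)) where
  cont := by
    have := cl_cont T
    refine intervalIntegral.continuous_parametric_intervalIntegral_of_continuous
      (f := fun (q : ℝ × ℝ) σ => 2 * Aop (fun z => z) F (cl T q.1 - σ ^ 2) σ q.2) ?_
      (s := fun q => √(cl T q.1)) (by fun_prop)
    exact continuous_const.mul ((Aop_cont wt_id h).comp
      (by fun_prop : Continuous fun x : (ℝ × ℝ) × ℝ => (cl T x.1.1 - x.2 ^ 2, x.2, x.1.2)))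
  nn := mul_nonneg (mul_nonneg (mul_nonneg h.nn cw_nonneg) (by linarith)) (by positivity)
  bd t u := by
    have hc := cl_nonneg T t
    have hc' := Real.sqrt_le_sqrt (cl_le hT t)
    have hX : 0 ≤ 2 * (C * cw * (1 + T) * (1 + u ^ 2)⁻¹) :=
      mul_nonneg zero_le_two
        (mul_nonneg (mul_nonneg (mul_nonneg h.nn cw_nonneg) (by linarith)) (w_pos u).le)
    have := intervalIntegral.norm_integral_le_of_norm_le_const (a := 0) (b := √(cl T t))
      (f := fun σ => 2 * Aop (fun z => z) F (cl T t - σ ^ 2) σ u)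
      (C := 2 * (C * cw * (1 + T) * (1 + u ^ 2)⁻¹))
      (fun s hs => by
        rw [uIoc_of_le (Real.sqrt_nonneg _)] at hs
        rw [norm_mul, Real.norm_eq_abs, Real.norm_eq_abs, abs_two]
        refine mul_le_mul_of_nonneg_left ((Aop_bd wt_id h _ _ _).trans ?_) zero_le_two
        refine mul_le_mul_of_nonneg_right
          (mul_le_mul_of_nonneg_left ?_ (mul_nonneg h.nn cw_nonneg)) (w_pos u).le
        have : s ^ 2 ≤ cl T t := by
          rw [← Real.sq_sqrt hc]; exact pow_le_pow_left₀ hs.1.le hs.2 2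
        linarith [cl_le hT t])
    refine this.trans ?_
    rw [sub_zero, abs_of_nonneg (Real.sqrt_nonneg _)]
    nlinarith [mul_le_mul_of_nonneg_left hc' hX]

lemma Dop_deriv {F F1 : ℝ → ℝ → ℝ} {C C1 : ℝ} (h : Src F C) (h1 : Src F1 C1)
    (hd : ∀ s u, HasDerivAt (F s) (F1 s u) u) (t u : ℝ) :
    HasDerivAt (Dop T F t) (Dop T F1 t u) u := by
  have hc : ∀ {G : ℝ → ℝ → ℝ} {D : ℝ}, Src G D → ∀ x : ℝ,
      Continuous fun s => Aop (fun _ => 1) G s (√(cl T t - s)) x := fun hG x =>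
    (Aop_cont wt_one hG).comp (by fun_prop : Continuous fun s : ℝ => (s, √(cl T t - s), x))
  obtain ⟨B, hB⟩ := (isCompact_uIcc (a := (0:ℝ)) (b := cl T t)).bddAbove_image
    (f := fun s => C1 * cw * (1 + √(cl T t - s) ^ 2)) (by fun_prop)
  refine (intervalIntegral.hasDerivAt_integral_of_dominated_loc_of_deriv_le (s := univ)
    (F := fun x s => Aop (fun _ => 1) F s (√(cl T t - s)) x)
    (F' := fun x s => Aop (fun _ => 1) F1 s (√(cl T t - s)) x) (bound := fun _ => B)
    univ_mem (Eventually.of_forall fun x => (hc h x).aestronglyMeasurable)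
    ((hc h u).intervalIntegrable _ _) (hc h1 u).aestronglyMeasurable
    (ae_of_all _ fun s hs x _ => ?_) (by simp)
    (ae_of_all _ fun s hs x _ => Aop_deriv h h1 hd s _ x)).2
  refine (Aop_bd wt_one h1 _ _ _).trans ?_
  have h2 := hB (mem_image_of_mem _ (uIoc_subset_uIcc hs))
  refine le_trans ?_ h2
  have : 0 ≤ C1 * cw * (1 + √(cl T t - s) ^ 2) :=
    mul_nonneg (mul_nonneg h1.nn cw_nonneg) (by positivity)
  exact mul_le_of_le_one_right this (w_le x)

lemma Dop_eq_D1 {F F1 : ℝ → ℝ → ℝ} {C C1 : ℝ} (h : Src F C) (h1 : Src F1 C1)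
    (hd : ∀ s u, HasDerivAt (F s) (F1 s u) u) (t u : ℝ) :
    Dop T F1 t u = D1op T F t u := by
  have hc := cl_nonneg T t
  set c := cl T t with hcd
  have key := intervalIntegral.integral_comp_mul_deriv (a := √c) (b := 0)
    (f := fun σ : ℝ => c - σ ^ 2) (f' := fun σ => - (2 * σ))
    (g := fun s => Aop (fun _ => 1) F1 s (√(c - s)) u)
    (fun x _ => by simpa using ((hasDerivAt_id x).pow 2).const_sub c)
    (by fun_prop)
    ((Aop_cont wt_one h1).comp (by fun_prop : Continuous fun s : ℝ => (s, √(c - s), u)))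
  rw [Real.sq_sqrt hc, sub_self, show c - 0 ^ 2 = c by ring] at key
  rw [Dop, D1op, ← hcd, ← key, intervalIntegral.integral_symm, ← intervalIntegral.integral_neg]
  refine intervalIntegral.integral_congr fun σ hσ => ?_
  rw [uIcc_of_le (Real.sqrt_nonneg _)] at hσ
  simp only [Function.comp, sub_sub_cancel, Real.sqrt_sq hσ.1]
  rw [Aop_ibp h h1 hd]; ring

lemma Dop_heat {F F1 F2 : ℝ → ℝ → ℝ} {C C1 C2 : ℝ} (h : Src F C) (h1 : Src F1 C1) (h2 : Src F2 C2)
    (hd : ∀ s u, HasDerivAt (F s) (F1 s u) u) (hd1 : ∀ s u, HasDerivAt (F1 s) (F2 s u) u)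
    (t u : ℝ) (h0 : 0 ≤ t) (htT : t ≤ T) :
    Dop T F t u = ∫ r in (0:ℝ)..t, (F r u + (1/2) * Dop T F2 r u) := by
  rw [Dop, cl_eq h0 htT]
  have e1 : ∀ s ∈ uIcc 0 t, Aop (fun _ => 1) F s (√(t - s)) u
      = F s u + ∫ r in s..t, (1/2) * Aop (fun _ => 1) F2 s (√(r - s)) u := fun s hs => by
    rw [uIcc_of_le h0] at hs
    rw [← Aop_heat h h1 h2 hd hd1 s u s t hs.2]; ring
  have hq : Continuous (fun p : ℝ × ℝ => (1/2) * Aop (fun _ => 1) F2 p.2 (√(p.1 - p.2)) u) :=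
    continuous_const.mul ((Aop_cont wt_one h2).comp
      (by fun_prop : Continuous fun p : ℝ × ℝ => (p.2, √(p.1 - p.2), u)))
  have tri := triangle (q := fun r s => (1/2) * Aop (fun _ => 1) F2 s (√(r - s)) u) hq t h0
  have hT' : 0 ≤ T := h0.trans htT
  have e2 : IntervalIntegrable (fun s => ∫ r in s..t, (1/2) * Aop (fun _ => 1) F2 s (√(r - s)) u) volume 0 t := by
    apply Continuous.intervalIntegrable
    have : Continuous fun s => - ∫ r in t..s, (1/2) * Aop (fun _ => 1) F2 s (√(r - s)) u :=
      (intervalIntegral.continuous_parametric_intervalIntegral_of_continuous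
        (f := fun s r => (1/2) * Aop (fun _ => 1) F2 s (√(r - s)) u)
        (hq.comp continuous_swap) continuous_id).neg
    refine this.congr fun s => ?_
    rw [intervalIntegral.integral_symm s t, neg_neg]
  rw [intervalIntegral.integral_congr e1, intervalIntegral.integral_add
    ((h.cont1 u).intervalIntegrable _ _) e2, tri, ← intervalIntegral.integral_add
    ((h.cont1 u).intervalIntegrable _ _)]
  · refine intervalIntegral.integral_congr fun r hr => ?_
    rw [uIcc_of_le h0] at hr
    rw [Dop, cl_eq hr.1 (hr.2.trans htT), intervalIntegral.integral_const_mul]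
  · apply Continuous.intervalIntegrable
    exact intervalIntegral.continuous_parametric_intervalIntegral_of_continuous
        (f := fun r s => (1/2) * Aop (fun _ => 1) F2 s (√(r - s)) u) hq continuous_id

end ops

structure Ident (T χ : ℝ) (ψ : ℝ → ℝ) (m d F : ℝ → ℝ → ℝ) : Prop where
  a : ∀ t a b, m t b - m t a = ∫ u in a..b, d t u
  b : ∀ t, 0 ≤ t → t ≤ T → ∀ a b, (1/2) * ∫ r in (0:ℝ)..t, (d r b - d r a)
      = (∫ u in a..b, (m t u - ψ u)) + χ * ∫ r in (0:ℝ)..t, ∫ u in a..b, F r u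
  c : (∫ u, m T u ^ 2) - ∫ u, ψ u ^ 2 = ∫ t in (0:ℝ)..T, ∫ u, (- d t u ^ 2 - 2 * χ * (m t u * F t u))

lemma ident_smooth {T χ : ℝ} (hT : 0 < T) {ψ : ℝ → ℝ} {m d e F : ℝ → ℝ → ℝ} {Cp Cm Cd Ce CF : ℝ}
    (hp : Src (fun _ => ψ) Cp)
    (hm : Src m Cm) (hd : Src d Cd) (he : Src e Ce) (hF : Src F CF)
    (hmd : ∀ t u, HasDerivAt (m t) (d t u) u) (hde : ∀ t u, HasDerivAt (d t) (e t u) u)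
    (heq : ∀ t u, 0 ≤ t → t ≤ T → m t u = ψ u + ∫ r in (0:ℝ)..t, ((1/2) * e r u - χ * F r u)) :
    Ident T χ ψ m d F where
  a t a b := by
    rw [intervalIntegral.integral_eq_sub_of_hasDerivAt (fun x _ => hmd t x)
      ((hd.cont2 t).intervalIntegrable _ _)]
  b t h0 htT a b := by
    have e1 : ∀ r, d r b - d r a = ∫ u in a..b, e r u := fun r => by
      rw [intervalIntegral.integral_eq_sub_of_hasDerivAt (fun x _ => hde r x)
      ((he.cont2 r).intervalIntegrable _ _)]
    simp_rw [e1]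
    rw [swap_interval he.cont, swap_interval hF.cont, ← intervalIntegral.integral_const_mul,
      ← intervalIntegral.integral_const_mul, ← intervalIntegral.integral_add]
    · refine intervalIntegral.integral_congr fun u _ => ?_
      rw [heq t u h0 htT, intervalIntegral.integral_sub, intervalIntegral.integral_const_mul,
        intervalIntegral.integral_const_mul]
      · ring
      · exact (continuous_const.mul (he.cont1 u)).intervalIntegrable _ _
      · exact (continuous_const.mul (hF.cont1 u)).intervalIntegrable _ _
    · exact ((hm.cont2 t).sub (hp.cont2 0)).intervalIntegrable _ _
    · apply Continuous.intervalIntegrable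
      exact continuous_const.mul (intervalIntegral.continuous_parametric_intervalIntegral_of_continuous'
        (f := fun u r => F r u) (hF.cont.comp continuous_swap) _ _)
  c := by
    set G : ℝ → ℝ → ℝ := fun t u => 2 * (m t u * ((1/2) * e t u - χ * F t u)) with hG
    have sG : Src G _ := (hm.mul ((he.cmul (1/2)).sub (hF.cmul χ))).cmul 2
    have hrhs : ∀ u, Continuous fun r => (1/2) * e r u - χ * F r u := fun u =>
      (continuous_const.mul (he.cont1 u)).sub (continuous_const.mul (hF.cont1 u))
    have e0 : ∀ u, m 0 u = ψ u := fun u => by simpa using heq 0 u le_rfl hT.le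
    have e1 : ∀ u, m T u ^ 2 - ψ u ^ 2 = ∫ t in (0:ℝ)..T, G t u := fun u => by
      rw [intervalIntegral.integral_eq_sub_of_hasDerivAt_of_le hT.le (f := fun t => m t u ^ 2), e0]
      · exact ((hm.cont1 u).pow 2).continuousOn
      · intro t ht
        have h1 : HasDerivAt (fun t => ψ u + ∫ r in (0:ℝ)..t, ((1/2) * e r u - χ * F r u))
            ((1/2) * e t u - χ * F t u) t :=
          (intervalIntegral.integral_hasDerivAt_right ((hrhs u).intervalIntegrable _ _)
            ((hrhs u).stronglyMeasurableAtFilter _ _) (hrhs u).continuousAt).const_add _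
        have h2 : HasDerivAt (fun t => m t u) ((1/2) * e t u - χ * F t u) t := by
          refine h1.congr_of_eventuallyEq ?_
          filter_upwards [Ioo_mem_nhds ht.1 ht.2] with x hx
          exact heq x u hx.1.le hx.2.le
        refine (h2.pow 2).congr_deriv ?_
        simp [hG]; ring
      · exact (sG.cont1 u).intervalIntegrable _ _
    rw [← integral_sub (hm.sq.integrable T) (hp.sq.integrable 0)]
    simp_rw [e1]
    rw [← sG.swap]
    refine intervalIntegral.integral_congr fun t _ => ?_
    have ibp := integral_mul_deriv_eq_deriv_mul_of_integrable (u := m t) (v := d t) (u' := d t)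
      (v' := e t) (fun x _ => hmd t x) (fun x _ => hde t x) ((hm.mul he).integrable t)
      ((hd.mul hd).integrable t) ((hm.mul hd).integrable t)
    have r1 : ∀ u, G t u = m t u * e t u - 2 * χ * (m t u * F t u) := fun u => by simp [hG]; ring
    simp_rw [r1]
    have q1 : Integrable fun u => - d t u ^ 2 := (hd.sq.integrable t).neg
    rw [integral_sub ((hm.mul he).integrable t) (((hm.mul hF).integrable t).const_mul _), ibp,
      integral_sub q1 (((hm.mul hF).integrable t).const_mul _), integral_neg]
    simp [pow_two]

lemma ident_limit {T χ : ℝ} {ψ : ℝ → ℝ} {m d F : ℕ → ℝ → ℝ → ℝ} {m' d' F' : ℝ → ℝ → ℝ}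
    {Cm Cd CF : ℝ} (hm : ∀ n, Src (m n) Cm) (hd : ∀ n, Src (d n) Cd) (hF : ∀ n, Src (F n) CF)
    (lm : ∀ t u, Tendsto (fun n => m n t u) atTop (𝓝 (m' t u)))
    (ld : ∀ t u, Tendsto (fun n => d n t u) atTop (𝓝 (d' t u)))
    (lF : ∀ t u, Tendsto (fun n => F n t u) atTop (𝓝 (F' t u)))
    (hm' : Src m' Cm) (hψ : Continuous ψ)
    (hI : ∀ n, Ident T χ ψ (m n) (d n) (F n)) : Ident T χ ψ m' d' F' where
  a t a b := by
    refine tendsto_nhds_unique ((lm t b).sub (lm t a)) ?_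
    simp_rw [fun n => (hI n).a t a b]
    exact intervalIntegral.tendsto_integral_filter_of_dominated_convergence (fun _ => Cd)
      (Eventually.of_forall fun n => ((hd n).cont2 t).aestronglyMeasurable)
      (Eventually.of_forall fun n => ae_of_all _ fun u _ => (hd n).bd1 t u) (by simp)
      (ae_of_all _ fun u _ => ld t u)
  b t h0 htT a b := by
    refine tendsto_nhds_unique (f := fun n => (1/2) * ∫ r in (0:ℝ)..t, (d n r b - d n r a))
      (l := atTop) (Tendsto.const_mul _ ?_) ?_
    · exact intervalIntegral.tendsto_integral_filter_of_dominated_convergence (fun _ => Cd + Cd)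
        (Eventually.of_forall fun n => (((hd n).cont1 b).sub ((hd n).cont1 a)).aestronglyMeasurable)
        (Eventually.of_forall fun n => ae_of_all _ fun r _ =>
          (abs_sub _ _).trans (add_le_add ((hd n).bd1 r b) ((hd n).bd1 r a))) (by simp)
        (ae_of_all _ fun r _ => (ld r b).sub (ld r a))
    · simp_rw [fun n => (hI n).b t h0 htT a b]
      have tF : ∀ r, Tendsto (fun n => ∫ u in a..b, F n r u) atTop (𝓝 (∫ u in a..b, F' r u)) := fun r =>
        intervalIntegral.tendsto_integral_filter_of_dominated_convergence (fun _ => CF)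
        (Eventually.of_forall fun n => ((hF n).cont2 r).aestronglyMeasurable)
        (Eventually.of_forall fun n => ae_of_all _ fun u _ => (hF n).bd1 r u) (by simp)
        (ae_of_all _ fun u _ => lF r u)
      refine Tendsto.add ?_ (Tendsto.const_mul _ ?_)
      · have : ∀ x : ℝ → ℝ, Continuous x → ∫ u in a..b, (x u - ψ u) = (∫ u in a..b, x u) - ∫ u in a..b, ψ u :=
          fun x hx => intervalIntegral.integral_sub (hx.intervalIntegrable _ _) (hψ.intervalIntegrable _ _)
        rw [this _ (hm'.cont2 t)]
        simp_rw [fun n => this _ ((hm n).cont2 t)]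
        exact Tendsto.sub_const (intervalIntegral.tendsto_integral_filter_of_dominated_convergence (fun _ => Cm)
          (Eventually.of_forall fun n => ((hm n).cont2 t).aestronglyMeasurable)
          (Eventually.of_forall fun n => ae_of_all _ fun u _ => (hm n).bd1 t u) (by simp)
          (ae_of_all _ fun u _ => lm t u)) _
      · refine intervalIntegral.tendsto_integral_filter_of_dominated_convergence (fun _ => CF * |b - a|)
          (Eventually.of_forall fun n => (intervalIntegral.continuous_parametric_intervalIntegral_of_continuous'
            (f := fun r u => F n r u) (hF n).cont _ _).aestronglyMeasurable)
          (Eventually.of_forall fun n => ae_of_all _ fun r _ =>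
            intervalIntegral.norm_integral_le_of_norm_le_const fun u _ => (hF n).bd1 r u) (by simp)
          (ae_of_all _ fun r _ => tF r)
  c := by
    have t1 : Tendsto (fun n => (∫ u, m n T u ^ 2) - ∫ u, ψ u ^ 2) atTop
        (𝓝 ((∫ u, m' T u ^ 2) - ∫ u, ψ u ^ 2)) :=
      Tendsto.sub_const (tendsto_integral_of_dominated_convergence _
        (fun n => ((hm n).sq.cont2 T).aestronglyMeasurable)
        (integrable_inv_one_add_sq.const_mul (Cm * Cm))
        (fun n => ae_of_all _ fun u => (hm n).sq.bd T u) (ae_of_all _ fun u => (lm T u).pow 2)) _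
    refine tendsto_nhds_unique t1 ?_
    simp_rw [fun n => (hI n).c]
    have sG : ∀ n, Src (fun t u => (-1) * d n t u ^ 2 - 2 * χ * (m n t u * F n t u)) _ := fun n =>
      ((hd n).sq.cmul (-1)).sub (((hm n).mul (hF n)).cmul (2 * χ))
    simp only [neg_one_mul] at sG
    refine intervalIntegral.tendsto_integral_filter_of_dominated_convergence
      (fun _ => ∫ u : ℝ, (|(-1 : ℝ)| * (Cd * Cd) + |2 * χ| * (Cm * CF)) * (1 + u ^ 2)⁻¹)
      (Eventually.of_forall fun n => (sG n).cont_int.aestronglyMeasurable)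
      (Eventually.of_forall fun n => ae_of_all _ fun t _ =>
        norm_integral_le_of_norm_le (integrable_inv_one_add_sq.const_mul _)
          (ae_of_all _ fun u => (sG n).bd t u)) (by simp)
      (ae_of_all _ fun t _ => ?_)
    exact tendsto_integral_of_dominated_convergence _
        (fun n => ((sG n).cont2 t).aestronglyMeasurable)
        (integrable_inv_one_add_sq.const_mul _)
        (fun n => ae_of_all _ fun u => (sG n).bd t u)
        (ae_of_all _ fun u => ((ld t u).pow 2).neg.sub (((lm t u).mul (lF t u)).const_mul _))

lemma Src.mono {F : ℝ → ℝ → ℝ} {C D : ℝ} (h : Src F C) (hCD : C ≤ D) : Src F D :=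
  ⟨h.cont, h.nn.trans hCD, fun s u => (h.bd s u).trans
    (mul_le_mul_of_nonneg_right hCD (w_pos u).le)⟩

lemma Aop_bd1 {p : ℝ → ℝ} (hp : Wt p) {F : ℝ → ℝ → ℝ} {C : ℝ} (h : Src F C) (s σ u : ℝ) :
    |Aop p F s σ u| ≤ C * ∫ z, (1 + z ^ 2) ^ 2 ∂(gaussianReal 0 1) := by
  have := norm_integral_le_of_norm_le (μ := (gaussianReal 0 1)) (f := fun z => p z * F s (u + σ * z))
    (int_w4.const_mul C) (ae_of_all _ fun z => Aop_ptbd' hp h s σ u z)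
  rwa [integral_const_mul] at this

section limits
variable {F : ℕ → ℝ → ℝ → ℝ} {F' : ℝ → ℝ → ℝ} {C : ℝ}

lemma Aop_lim (hF : ∀ n, Src (F n) C)
    (lF : ∀ t u, Tendsto (fun n => F n t u) atTop (𝓝 (F' t u)))
    {p : ℝ → ℝ} (hp : Wt p) (s σ u : ℝ) :
    Tendsto (fun n => Aop p (F n) s σ u) atTop (𝓝 (Aop p F' s σ u)) :=
  tendsto_integral_of_dominated_convergence _ (fun n => Aop_meas hp (hF n) s σ u)
    (int_w4.const_mul C) (fun n => ae_of_all _ fun z => Aop_ptbd' hp (hF n) s σ u z)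
    (ae_of_all _ fun z => (lF s _).const_mul _)

lemma Dop_lim (hF : ∀ n, Src (F n) C)
    (lF : ∀ t u, Tendsto (fun n => F n t u) atTop (𝓝 (F' t u)))
    (T t u : ℝ) : Tendsto (fun n => Dop T (F n) t u) atTop (𝓝 (Dop T F' t u)) :=
  intervalIntegral.tendsto_integral_filter_of_dominated_convergence
    (fun _ => C * ∫ z, (1 + z ^ 2) ^ 2 ∂(gaussianReal 0 1))
    (Eventually.of_forall fun n => ((Aop_cont wt_one (hF n)).comp
      (by fun_prop : Continuous fun s : ℝ => (s, √(cl T t - s), u))).aestronglyMeasurable)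
    (Eventually.of_forall fun n => ae_of_all _ fun s _ => Aop_bd1 wt_one (hF n) _ _ _) (by simp)
    (ae_of_all _ fun s _ => Aop_lim hF lF wt_one _ _ _)

lemma D1op_lim (hF : ∀ n, Src (F n) C)
    (lF : ∀ t u, Tendsto (fun n => F n t u) atTop (𝓝 (F' t u)))
    (T t u : ℝ) : Tendsto (fun n => D1op T (F n) t u) atTop (𝓝 (D1op T F' t u)) :=
  intervalIntegral.tendsto_integral_filter_of_dominated_convergence
    (fun _ => 2 * (C * ∫ z, (1 + z ^ 2) ^ 2 ∂(gaussianReal 0 1)))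
    (Eventually.of_forall fun n => (continuous_const.mul ((Aop_cont wt_id (hF n)).comp
      (by fun_prop : Continuous fun s : ℝ => (cl T t - s ^ 2, s, u)))).aestronglyMeasurable)
    (Eventually.of_forall fun n => ae_of_all _ fun s _ => by
      rw [norm_mul, Real.norm_eq_abs, Real.norm_eq_abs, abs_two]
      exact mul_le_mul_of_nonneg_left (Aop_bd1 wt_id (hF n) _ _ _) zero_le_two) (by simp)
    (ae_of_all _ fun s _ => (Aop_lim hF lF wt_id _ _ _).const_mul 2)

end limits

noncomputable def mop (T χ : ℝ) (ψ : ℝ → ℝ) (F : ℝ → ℝ → ℝ) (t u : ℝ) : ℝ :=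
  Pop T ψ t u - χ * Dop T F t u
noncomputable def dop (T χ : ℝ) (ψ1 : ℝ → ℝ) (F : ℝ → ℝ → ℝ) (t u : ℝ) : ℝ :=
  Pop T ψ1 t u - χ * D1op T F t u

lemma mop_src {T : ℝ} (hT : 0 ≤ T) (χ : ℝ) {ψ : ℝ → ℝ} {F : ℝ → ℝ → ℝ} {Cp C : ℝ}
    (hp : Src (fun _ => ψ) Cp) (hF : Src F C) :
    Src (mop T χ ψ F) (Cp * cw * (1 + T) + |χ| * (C * cw * (1 + T) * T)) :=
  (Pop_src hT hp).sub ((Dop_src hT hF).cmul χ)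

lemma dop_src {T : ℝ} (hT : 0 ≤ T) (χ : ℝ) {ψ : ℝ → ℝ} {F : ℝ → ℝ → ℝ} {Cp C : ℝ}
    (hp : Src (fun _ => ψ) Cp) (hF : Src F C) :
    Src (dop T χ ψ F) (Cp * cw * (1 + T) + |χ| * (C * cw * (1 + T) * (2 * √T))) :=
  (Pop_src hT hp).sub ((D1op_src hT hF).cmul χ)

lemma ident_F {T χ : ℝ} (hT : 0 < T) {ψ ψ1 ψ2 : ℝ → ℝ} {F F1 F2 : ℝ → ℝ → ℝ}
    {Cp Cp1 Cp2 C C1 C2 : ℝ}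
    (hp : Src (fun _ => ψ) Cp) (hp1 : Src (fun _ => ψ1) Cp1) (hp2 : Src (fun _ => ψ2) Cp2)
    (hpd : ∀ u, HasDerivAt ψ (ψ1 u) u) (hpd1 : ∀ u, HasDerivAt ψ1 (ψ2 u) u)
    (h : Src F C) (h1 : Src F1 C1) (h2 : Src F2 C2)
    (hd : ∀ s u, HasDerivAt (F s) (F1 s u) u) (hd1 : ∀ s u, HasDerivAt (F1 s) (F2 s u) u) :
    Ident T χ ψ (mop T χ ψ F) (dop T χ ψ1 F) F := by
  have hD1 : dop T χ ψ1 F = mop T χ ψ1 F1 := by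
    funext t u; rw [dop, mop, Dop_eq_D1 h h1 hd]
  refine ident_smooth hT hp (mop_src hT.le χ hp h) (dop_src hT.le χ hp1 h)
    (mop_src hT.le χ hp2 h2) h ?_ ?_ ?_
  · intro t u
    rw [hD1]
    exact (Aop_deriv hp hp1 (fun _ => hpd) 0 _ u).sub ((Dop_deriv h h1 hd t u).const_mul χ)
  · intro t u
    rw [hD1]
    exact (Aop_deriv hp1 hp2 (fun _ => hpd1) 0 _ u).sub ((Dop_deriv h1 h2 hd1 t u).const_mul χ)
  · intro t u h0 htT
    have e1 : Pop T ψ t u - ψ u = ∫ r in (0:ℝ)..t, (1/2) * Pop T ψ2 r u := by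
      have := Aop_heat hp hp1 hp2 (fun _ => hpd) (fun _ => hpd1) 0 u 0 t h0
      simp only [sub_zero] at this
      rw [Pop, cl_eq h0 htT, this]
      refine intervalIntegral.integral_congr fun r hr => ?_
      rw [uIcc_of_le h0] at hr
      show _ = (1/2) * Pop T ψ2 r u
      rw [Pop, cl_eq hr.1 (hr.2.trans htT)]
    have e2 := Dop_heat h h1 h2 hd hd1 t u h0 htT
    have i1 : IntervalIntegrable (fun r => (1/2) * Pop T ψ2 r u) volume 0 t :=
      (continuous_const.mul ((Pop_src hT.le hp2).cont1 u)).intervalIntegrable _ _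
    have i2 : IntervalIntegrable (fun r => F r u + (1/2) * Dop T F2 r u) volume 0 t :=
      ((h.cont1 u).add (continuous_const.mul ((Dop_src hT.le h2).cont1 u))).intervalIntegrable _ _
    have e3 : mop T χ ψ F t u = ψ u + ((∫ r in (0:ℝ)..t, (1/2) * Pop T ψ2 r u)
        - χ * ∫ r in (0:ℝ)..t, (F r u + (1/2) * Dop T F2 r u)) := by
      rw [← e1, ← e2, mop]; ring
    rw [e3, ← intervalIntegral.integral_const_mul, ← intervalIntegral.integral_sub i1 (i2.const_mul χ)]
    congr 1
    refine intervalIntegral.integral_congr fun r _ => ?_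
    simp only [mop]; ring

noncomputable def sd (δ : ℝ) (G : ℝ → ℝ → ℝ) (s u : ℝ) : ℝ :=
  (1 / δ ^ 2) * (G s (u + 2 * δ) - 2 * G s (u + δ) + G s u)

lemma sd_src (δ : ℝ) {G : ℝ → ℝ → ℝ} {C : ℝ} (h : Src G C) : ∃ D, Src (sd δ G) D :=
  ⟨_, (((h.shift (2 * δ)).sub ((h.shift δ).cmul 2)).add h).cmul (1 / δ ^ 2)⟩

lemma sd_deriv (δ : ℝ) {G G1 : ℝ → ℝ → ℝ} (hd : ∀ s u, HasDerivAt (G s) (G1 s u) u) (s u : ℝ) :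
    HasDerivAt (sd δ G s) (sd δ G1 s u) u :=
  ((((hd s (u + 2 * δ)).comp_add_const u (2 * δ)).sub
    (((hd s (u + δ)).comp_add_const u δ).const_mul 2)).add (hd s u)).const_mul _

lemma sd_mvt {δ : ℝ} (hδ : 0 < δ) {G G1 G2 : ℝ → ℝ → ℝ} (hd : ∀ s u, HasDerivAt (G s) (G1 s u) u)
    (hd1 : ∀ s u, HasDerivAt (G1 s) (G2 s u) u) (s u : ℝ) :
    ∃ x, 0 ≤ x ∧ x ≤ 2 * δ ∧ sd δ G s u = G2 s (u + x) := by
  have hq : ∀ x, HasDerivAt (fun x => G s (x + δ) - G s x) (G1 s (x + δ) - G1 s x) x := fun x =>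
    ((hd s (x + δ)).comp_add_const x δ).sub (hd s x)
  obtain ⟨y, hy, ey⟩ := exists_hasDerivAt_eq_slope _ _ (lt_add_of_pos_right u hδ)
    (fun x _ => (hq x).continuousAt.continuousWithinAt) (fun x _ => hq x)
  obtain ⟨z, hz, ez⟩ := exists_hasDerivAt_eq_slope (G1 s) (G2 s) (lt_add_of_pos_right y hδ)
    (fun x _ => (hd1 s x).continuousAt.continuousWithinAt) (fun x _ => hd1 s x)
  refine ⟨z - u, by linarith [hy.1, hz.1], by linarith [hy.2, hz.2], ?_⟩
  rw [add_sub_cancel, ez, ey, sd]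
  rw [show u + δ + δ = u + 2 * δ by ring]
  simp only [add_sub_cancel_left]
  field_simp
  ring

lemma ident_H {T χ : ℝ} (hT : 0 < T) {ψ ψ1 ψ2 : ℝ → ℝ} {H H1 H2 : ℝ → ℝ → ℝ}
    {Cp Cp1 Cp2 C C1 C2 : ℝ}
    (hp : Src (fun _ => ψ) Cp) (hp1 : Src (fun _ => ψ1) Cp1) (hp2 : Src (fun _ => ψ2) Cp2)
    (hpd : ∀ u, HasDerivAt ψ (ψ1 u) u) (hpd1 : ∀ u, HasDerivAt ψ1 (ψ2 u) u)
    (h : Src H C) (h1 : Src H1 C1) (h2 : Src H2 C2)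
    (hd : ∀ s u, HasDerivAt (H s) (H1 s u) u) (hd1 : ∀ s u, HasDerivAt (H1 s) (H2 s u) u) :
    Ident T χ ψ (mop T χ ψ H2) (dop T χ ψ1 H2) H2 := by
  set δ : ℕ → ℝ := fun n => 1 / ((n : ℝ) + 1) with hδd
  have hδ : ∀ n, 0 < δ n := fun n => by simp only [hδd]; positivity
  have hδ1 : ∀ n, δ n ≤ 1 := fun n => by
    simp only [hδd]; rw [div_le_one (by positivity)]; linarith [(Nat.cast_nonneg n : (0:ℝ) ≤ n)]
  have lδ : Tendsto δ atTop (𝓝 0) := tendsto_one_div_add_atTop_nhds_zero_nat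
  have h2' : Src H2 (C2 * 10) := h2.mono (by linarith [h2.nn])
  have hF : ∀ n, Src (sd (δ n) H) (C2 * 10) := fun n => by
    obtain ⟨D, hD⟩ := sd_src (δ n) h
    refine ⟨hD.cont, h2'.nn, fun s u => ?_⟩
    obtain ⟨x, hx0, hx1, hx⟩ := sd_mvt (hδ n) hd hd1 s u
    rw [hx, mul_assoc]
    refine (h2.bd s (u + x)).trans (mul_le_mul_of_nonneg_left ((w_shift u x).trans ?_) h2.nn)
    refine mul_le_mul_of_nonneg_right ?_ (w_pos u).le
    nlinarith [hδ1 n]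
  have lF : ∀ s u, Tendsto (fun n => sd (δ n) H s u) atTop (𝓝 (H2 s u)) := fun s u => by
    choose x hx0 hx1 hx using fun n => sd_mvt (hδ n) hd hd1 s u
    simp_rw [hx]
    have lx : Tendsto x atTop (𝓝 0) :=
      tendsto_of_tendsto_of_tendsto_of_le_of_le tendsto_const_nhds
        (by simpa using lδ.const_mul 2) hx0 hx1
    have := ((h2.cont2 s).tendsto (u + 0)).comp (lx.const_add u)
    simpa [Function.comp_def] using this
  refine ident_limit (fun n => mop_src hT.le χ hp (hF n)) (fun n => dop_src hT.le χ hp1 (hF n)) hF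
    (fun t u => ((Dop_lim hF lF T t u).const_mul χ).const_sub _)
    (fun t u => ((D1op_lim hF lF T t u).const_mul χ).const_sub _) lF (mop_src hT.le χ hp h2')
    (hp.cont2 0) fun n => ?_
  obtain ⟨D1, hD1⟩ := sd_src (δ n) h1
  obtain ⟨D2, hD2⟩ := sd_src (δ n) h2
  exact ident_F hT hp hp1 hp2 hpd hpd1 (hF n) hD1 hD2 (sd_deriv _ hd) (sd_deriv _ hd1)

lemma src_of_compact {G : ℝ → ℝ → ℝ} (hc : Continuous fun q : ℝ × ℝ => G q.1 q.2)
    (hs : HasCompactSupport fun q : ℝ × ℝ => G q.1 q.2) : ∃ C, Src G C := by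
  have hc2 : Continuous fun q : ℝ × ℝ => (1 + q.2 ^ 2) * G q.1 q.2 := by fun_prop
  obtain ⟨C, hC⟩ := (hs.mul_left (f := fun q : ℝ × ℝ => (1 + q.2 ^ 2))).exists_bound_of_continuous hc2
  refine ⟨C, hc, (norm_nonneg _).trans (hC 0), fun s u => ?_⟩
  have := hC (s, u)
  rw [← div_eq_mul_inv, le_div_iff₀ (by positivity)]
  simp only [Pi.mul_apply, norm_mul, Real.norm_eq_abs] at this
  rw [abs_of_pos (by positivity : 0 < 1 + u ^ 2)] at this
  linarith

lemma src_of_compact1 {ψ : ℝ → ℝ} (hc : Continuous ψ)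
    (hs : HasCompactSupport ψ) : ∃ C, Src (fun _ => ψ) C := by
  have hc2 : Continuous fun q : ℝ => (1 + q ^ 2) * ψ q := by fun_prop
  obtain ⟨C, hC⟩ := (hs.mul_left (f := fun q : ℝ => (1 + q ^ 2))).exists_bound_of_continuous hc2
  refine ⟨C, hc.comp continuous_snd, (norm_nonneg _).trans (hC 0), fun s u => ?_⟩
  have := hC u
  rw [← div_eq_mul_inv, le_div_iff₀ (by positivity)]
  simp only [Pi.mul_apply, norm_mul, Real.norm_eq_abs] at this
  rw [abs_of_pos (by positivity : 0 < 1 + u ^ 2)] at this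
  linarith

lemma compact_deriv {G : ℝ → ℝ → ℝ} (hs : HasCompactSupport fun q : ℝ × ℝ => G q.1 q.2) :
    HasCompactSupport fun q : ℝ × ℝ => deriv (G q.1) q.2 := by
  refine HasCompactSupport.intro hs fun q hq => ?_
  have h1 : (fun q : ℝ × ℝ => G q.1 q.2) =ᶠ[𝓝 q] 0 := notMem_tsupport_iff_eventuallyEq.1 hq
  have h2 : Tendsto (fun u : ℝ => (q.1, u)) (𝓝 q.2) (𝓝 q) :=
    (by fun_prop : Continuous fun u : ℝ => (q.1, u)).tendsto q.2
  have h3 : G q.1 =ᶠ[𝓝 q.2] fun _ => 0 := h2.eventually h1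
  rw [h3.deriv_eq]; simp
/-- With `J = −(1/2)∂_u μ + χ ∂_u H` and `K(t,u) = ∫₀ᵗ J(s,u) ds`, one has
`(1/2)∫ψ² + (χ²/2)∫₀ᵀ∫(∂_u H)² = (1/2)∫₀ᵀ∫(∂_t K)² + (1/4)∫(∂_u K(T,·))²
 + (1/8)∫₀ᵀ∫(ψ' − ∂_u² K)² + (1/2)∫[ψ² − ψ ∂_u K(T,·)]`. -/
theorem rate_functional_identity (T ρ χ : ℝ) (hT : 0 < T) (hρ : ρ ∈ Set.Ioo (0:ℝ) 1)
    (hχ : χ = ρ * (1 - ρ))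
    (ψ : ℝ → ℝ) (hψ : ContDiff ℝ 2 ψ) (hψc : HasCompactSupport ψ)
    (H : ℝ → ℝ → ℝ)
    (hH1 : ∀ u, ContDiff ℝ 1 fun t => H t u)
    (hH2 : ∀ t, ContDiff ℝ 2 fun u => H t u)
    (hHt : Continuous fun q : ℝ × ℝ => deriv (fun t => H t q.2) q.1)
    (hHu : Continuous fun q : ℝ × ℝ => deriv (H q.1) q.2)
    (hHuu : Continuous fun q : ℝ × ℝ => deriv (deriv (H q.1)) q.2)
    (hHcont : Continuous fun q : ℝ × ℝ => H q.1 q.2)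
    (hHsupp : HasCompactSupport fun q : ℝ × ℝ => H q.1 q.2)
    (μ : ℝ → ℝ → ℝ)
    (hμ0 : ∀ u, μ 0 u = ψ u)
    (hμ : ∀ t ∈ Set.Ioc (0:ℝ) T, ∀ u, μ t u =
      (∫ v, heatK t (u - v) * ψ v) -
        χ * ∫ s in (0:ℝ)..t, ∫ v, heatK' (t - s) (u - v) * deriv (H s) v)
    (J K : ℝ → ℝ → ℝ)
    (hJ : ∀ t u, J t u = -(1/2) * deriv (μ t) u + χ * deriv (H t) u)
    (hK : ∀ t u, K t u = ∫ s in (0:ℝ)..t, J s u) :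
    (1/2) * (∫ u, (ψ u) ^ 2) +
        (χ ^ 2 / 2) * ∫ t in (0:ℝ)..T, ∫ u, (deriv (H t) u) ^ 2 =
      (1/2) * (∫ t in (0:ℝ)..T, ∫ u, (deriv (fun r => K r u) t) ^ 2) +
        (1/4) * (∫ u, (deriv (K T) u) ^ 2) +
        (1/8) * (∫ t in (0:ℝ)..T, ∫ u, (deriv ψ u - deriv (deriv (K t)) u) ^ 2) +
        (1/2) * ∫ u, ((ψ u) ^ 2 - ψ u * deriv (K T) u) := by
  obtain ⟨Cp, hp⟩ := src_of_compact1 hψ.continuous hψc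
  have hψd : ContDiff ℝ 1 (deriv ψ) := ((contDiff_succ_iff_deriv (n := 1)).1 hψ).2.2
  obtain ⟨Cp1, hp1⟩ := src_of_compact1 hψd.continuous hψc.deriv
  obtain ⟨Cp2, hp2⟩ := src_of_compact1 (hψd.continuous_deriv le_rfl) hψc.deriv.deriv
  have hpd : ∀ u, HasDerivAt ψ (deriv ψ u) u := fun u =>
    (hψ.differentiable (by norm_num) u).hasDerivAt
  have hpd1 : ∀ u, HasDerivAt (deriv ψ) (deriv (deriv ψ) u) u := fun u =>
    (hψd.differentiable (by norm_num) u).hasDerivAt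
  obtain ⟨C, h⟩ := src_of_compact hHcont hHsupp
  obtain ⟨C1, h1⟩ := src_of_compact (G := fun s => deriv (H s)) hHu (compact_deriv hHsupp)
  obtain ⟨C2, h2⟩ := src_of_compact (G := fun s => deriv (deriv (H s))) hHuu
    (compact_deriv (G := fun s => deriv (H s)) (compact_deriv hHsupp))
  have hd : ∀ s u, HasDerivAt (H s) (deriv (H s) u) u := fun s u =>
    ((hH2 s).differentiable (by norm_num) u).hasDerivAt
  have hd1 : ∀ s u, HasDerivAt (deriv (H s)) (deriv (deriv (H s)) u) u := fun s u =>
    ((((contDiff_succ_iff_deriv (n := 1)).1 (hH2 s)).2.2).differentiable (by norm_num) u).hasDerivAt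
  have hI := ident_H (χ := χ) hT hp hp1 hp2 hpd hpd1 h h1 h2 hd hd1
  have sm := mop_src hT.le χ hp h2
  have sd' := dop_src hT.le χ hp1 h2
  set m := mop T χ ψ (fun s => deriv (deriv (H s))) with hm
  set d := dop T χ (deriv ψ) (fun s => deriv (deriv (H s))) with hdd
  have hmd : ∀ t u, HasDerivAt (m t) (d t u) u := fun t u => by
    have e : m t = fun x => m t 0 + ∫ y in (0:ℝ)..x, d t y := by
      funext x; rw [← hI.a t 0 x]; ring
    rw [e]
    exact (intervalIntegral.integral_hasDerivAt_right ((sd'.cont2 t).intervalIntegrable _ _)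
      ((sd'.cont2 t).stronglyMeasurableAtFilter _ _) (sd'.cont2 t).continuousAt).const_add _
  have hμm : ∀ t, 0 ≤ t → t ≤ T → μ t = m t := fun t h0 htT => by
    funext u
    rcases h0.eq_or_lt with rfl | h0'
    · rw [hμ0, hm, mop, Pop, Dop, cl_eq le_rfl htT, Real.sqrt_zero, Aop_zero]; simp
    · rw [hμ t ⟨h0', htT⟩ u, heat_A ψ t u h0', hm, mop, Pop, Dop, cl_eq h0 htT]
      congr 2
      refine intervalIntegral.integral_congr_Ioo_of_le h0 fun s hs => ?_
      exact heat_A' h1 h2 hd1 s (t - s) u (sub_pos.2 hs.2)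
  set Jc : ℝ → ℝ → ℝ := fun t u => -(1/2) * d t u + χ * deriv (H t) u with hJc
  have sJ : Src Jc _ := (sd'.cmul (-(1/2))).add (h1.cmul χ)
  have hJJ : ∀ t, 0 ≤ t → t ≤ T → ∀ u, J t u = Jc t u := fun t h0 htT u => by
    rw [hJ, hμm t h0 htT, (hmd t u).deriv]
  have hKK : ∀ t, 0 ≤ t → t ≤ T → ∀ u, K t u = ∫ s in (0:ℝ)..t, Jc s u := fun t h0 htT u => by
    rw [hK]
    refine intervalIntegral.integral_congr fun s hs => ?_
    rw [uIcc_of_le h0] at hs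
    exact hJJ s hs.1 (hs.2.trans htT) u
  have hKt : ∀ t ∈ Ioo 0 T, ∀ u, deriv (fun r => K r u) t = Jc t u := fun t ht u => by
    have e : (fun r => K r u) =ᶠ[𝓝 t] fun r => ∫ s in (0:ℝ)..r, Jc s u := by
      filter_upwards [Ioo_mem_nhds ht.1 ht.2] with x hx
      exact hKK x hx.1.le hx.2.le u
    rw [e.deriv_eq]
    exact (intervalIntegral.integral_hasDerivAt_right ((sJ.cont1 u).intervalIntegrable _ _)
      ((sJ.cont1 u).stronglyMeasurableAtFilter _ _) (sJ.cont1 u).continuousAt).deriv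
  have hKu : ∀ t, 0 ≤ t → t ≤ T → ∀ u, HasDerivAt (K t) (ψ u - m t u) u := fun t h0 htT u => by
    have hcont : Continuous fun y => ψ y - m t y := hψ.continuous.sub (sm.cont2 t)
    have e : K t = fun x => K t 0 + ∫ y in (0:ℝ)..x, (ψ y - m t y) := by
      funext x
      have b := hI.b t h0 htT 0 x
      have i0 : ∀ y, IntervalIntegrable (fun s => Jc s y) volume 0 t := fun y =>
        (sJ.cont1 y).intervalIntegrable _ _
      have k1 : K t x - K t 0 = ∫ s in (0:ℝ)..t, (Jc s x - Jc s 0) := by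
        rw [hKK t h0 htT, hKK t h0 htT, intervalIntegral.integral_sub (i0 x) (i0 0)]
      have i1 : IntervalIntegrable (fun r => d r x - d r 0) volume 0 t :=
        ((sd'.cont1 x).sub (sd'.cont1 0)).intervalIntegrable _ _
      have i2 : IntervalIntegrable (fun r => deriv (H r) x - deriv (H r) 0) volume 0 t :=
        ((h1.cont1 x).sub (h1.cont1 0)).intervalIntegrable _ _
      have k2 : ∫ s in (0:ℝ)..t, (Jc s x - Jc s 0) = -(1/2) * (∫ r in (0:ℝ)..t, (d r x - d r 0))
          + χ * ∫ r in (0:ℝ)..t, (deriv (H r) x - deriv (H r) 0) := by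
        rw [← intervalIntegral.integral_const_mul, ← intervalIntegral.integral_const_mul,
          ← intervalIntegral.integral_add (i1.const_mul _) (i2.const_mul _)]
        refine intervalIntegral.integral_congr fun s _ => ?_
        simp only [hJc]; ring
      have k3 : ∀ r, ∫ u in (0:ℝ)..x, deriv (deriv (H r)) u = deriv (H r) x - deriv (H r) 0 := fun r =>
        intervalIntegral.integral_eq_sub_of_hasDerivAt (fun y _ => hd1 r y)
          ((h2.cont2 r).intervalIntegrable _ _)
      simp_rw [k3] at b
      have k4 : ∫ y in (0:ℝ)..x, (ψ y - m t y) = - ∫ y in (0:ℝ)..x, (m t y - ψ y) := by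
        rw [← intervalIntegral.integral_neg]
        refine intervalIntegral.integral_congr fun s _ => ?_
        simp
      rw [k4]
      linarith
    rw [e]
    exact (intervalIntegral.integral_hasDerivAt_right (hcont.intervalIntegrable _ _)
      (hcont.stronglyMeasurableAtFilter _ _) hcont.continuousAt).const_add _
  have hKu' : ∀ t, 0 ≤ t → t ≤ T → deriv (K t) = fun u => ψ u - m t u := fun t h0 htT =>
    funext fun u => (hKu t h0 htT u).deriv
  have g1 : ∫ t in (0:ℝ)..T, ∫ u, (deriv (fun r => K r u) t) ^ 2 = ∫ t in (0:ℝ)..T, ∫ u, Jc t u ^ 2 := by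
    refine intervalIntegral.integral_congr_Ioo_of_le hT.le fun t ht => ?_
    simp_rw [hKt t ht]
  have g3 : ∫ t in (0:ℝ)..T, ∫ u, (deriv ψ u - deriv (deriv (K t)) u) ^ 2
      = ∫ t in (0:ℝ)..T, ∫ u, d t u ^ 2 := by
    refine intervalIntegral.integral_congr_Ioo_of_le hT.le fun t ht => ?_
    have : ∀ u, deriv (deriv (K t)) u = deriv ψ u - d t u := fun u => by
      rw [hKu' t ht.1.le ht.2.le]
      exact ((hpd u).sub (hmd t u)).deriv
    simp_rw [this, sub_sub_cancel]
  rw [g1, g3, hKu' T hT.le le_rfl]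
  have g2 : ∫ u, (ψ u - m T u) ^ 2 = (∫ u, ψ u ^ 2) - 2 * (∫ u, ψ u * m T u) + ∫ u, m T u ^ 2 := by
    rw [← integral_const_mul, ← integral_sub (hp.sq.integrable 0) (((hp.mul sm).integrable T).const_mul 2),
      ← integral_add _ (sm.sq.integrable T)]
    · refine integral_congr_ae (ae_of_all _ fun u => ?_)
      simp only; ring
    · exact (hp.sq.integrable 0).sub (((hp.mul sm).integrable T).const_mul 2)
  have g4 : ∫ u, (ψ u ^ 2 - ψ u * (ψ u - m T u)) = ∫ u, ψ u * m T u := by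
    refine integral_congr_ae (ae_of_all _ fun u => ?_)
    simp only; ring
  have c1 : ∀ {G : ℝ → ℝ → ℝ} {D : ℝ}, Src G D →
      IntervalIntegrable (fun t => ∫ u, G t u) volume 0 T := fun hG =>
    hG.cont_int.intervalIntegrable _ _
  have sdH := sd'.mul h1
  have g5 : ∫ t in (0:ℝ)..T, ∫ u, Jc t u ^ 2 = (1/4) * (∫ t in (0:ℝ)..T, ∫ u, d t u ^ 2)
      - χ * (∫ t in (0:ℝ)..T, ∫ u, d t u * deriv (H t) u)
      + χ ^ 2 * ∫ t in (0:ℝ)..T, ∫ u, deriv (H t) u ^ 2 := by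
    rw [← intervalIntegral.integral_const_mul, ← intervalIntegral.integral_const_mul,
      ← intervalIntegral.integral_const_mul,
      ← intervalIntegral.integral_sub ((c1 sd'.sq).const_mul _) ((c1 sdH).const_mul _),
      ← intervalIntegral.integral_add (((c1 sd'.sq).const_mul _).sub ((c1 sdH).const_mul _))
        ((c1 h1.sq).const_mul _)]
    refine intervalIntegral.integral_congr fun t _ => ?_
    rw [← integral_const_mul, ← integral_const_mul, ← integral_const_mul,
      ← integral_sub ((sd'.sq.integrable t).const_mul _) ((sdH.integrable t).const_mul _),
      ← integral_add _ ((h1.sq.integrable t).const_mul _)]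
    · refine integral_congr_ae (ae_of_all _ fun u => ?_)
      simp only [hJc]; ring
    · exact ((sd'.sq.integrable t).const_mul _).sub ((sdH.integrable t).const_mul _)
  have g6 : (∫ u, m T u ^ 2) - ∫ u, ψ u ^ 2 = - (∫ t in (0:ℝ)..T, ∫ u, d t u ^ 2)
      + 2 * χ * ∫ t in (0:ℝ)..T, ∫ u, d t u * deriv (H t) u := by
    have q0 : IntervalIntegrable (fun t => - ∫ u, d t u ^ 2) volume 0 T := (c1 sd'.sq).neg
    rw [hI.c, ← intervalIntegral.integral_const_mul, ← intervalIntegral.integral_neg,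
      ← intervalIntegral.integral_add q0 ((c1 sdH).const_mul _)]
    refine intervalIntegral.integral_congr fun t _ => ?_
    have ibp := integral_mul_deriv_eq_deriv_mul_of_integrable (u := m t) (v := deriv (H t)) (u' := d t)
      (v' := deriv (deriv (H t))) (fun x _ => hmd t x) (fun x _ => hd1 t x) ((sm.mul h2).integrable t)
      ((sd'.mul h1).integrable t) ((sm.mul h1).integrable t)
    have q1 : Integrable fun u => - d t u ^ 2 := (sd'.sq.integrable t).neg
    rw [integral_sub q1 (((sm.mul h2).integrable t).const_mul _), integral_neg, integral_const_mul, ibp]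
    ring
  rw [g2, g4, g5]
  linear_combination (-(1/4)) * g6
end

section
/- Let T > 0, ρ ∈ (0,1), χ = ρ(1−ρ), ψ ∈ C²_c(ℝ), H ∈ C^{1,2}_c([0,T]×ℝ), and let μ be defined by μ(t,u) = ∫_ℝ p_t(u−v) ψ(v) dv − χ ∫₀ᵗ ∫_ℝ p'_{t−s}(u−v) ∂_v H(s,v) dv ds for 0 < t ≤ T, with μ(0,·) = ψ. Then for every Schwartz function f on ℝ and every 0 ≤ t ≤ T, |∫_ℝ μ(t,u) f(u) du| ≤ ‖ψ‖_{L²(ℝ)} ‖f‖_{L²(ℝ)} + χ √T ‖f'‖_{L²(ℝ)} ( ∫₀ᵀ∫_ℝ (∂_u H(s,u))² du ds )^{1/2}. -/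
open Real MeasureTheory

open ProbabilityTheory

lemma aux_supp (F : ℝ → ℝ → ℝ) (h : HasCompactSupport fun q : ℝ × ℝ => F q.1 q.2) :
    HasCompactSupport fun q : ℝ × ℝ => deriv (F q.1) q.2 := by
  apply HasCompactSupport.intro h
  intro q hq
  have h1 := notMem_tsupport_iff_eventuallyEq.mp hq
  have h2 : Filter.Tendsto (fun v : ℝ => (q.1, v)) (nhds q.2) (nhds q) := by
    have : Continuous (fun v : ℝ => (q.1, v)) := by fun_prop
    exact this.tendsto q.2
  have h3 : F q.1 =ᶠ[nhds q.2] fun _ => 0 := h2.eventually h1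
  rw [h3.deriv_eq]; simp

lemma aux_section (F : ℝ → ℝ → ℝ) (h : HasCompactSupport fun q : ℝ × ℝ => F q.1 q.2) (s : ℝ) :
    HasCompactSupport (F s) := by
  apply HasCompactSupport.intro (h.isCompact.image continuous_snd)
  intro x hx
  by_contra h0
  exact hx ⟨(s, x), subset_tsupport _ h0, rfl⟩

lemma heatK_eq (t u : ℝ) (ht : 0 < t) : heatK t u = gaussianPDFReal 0 ⟨t, ht.le⟩ u := by
  unfold heatK gaussianPDFReal
  simp [div_eq_inv_mul]
  rfl

lemma aux_gauss (t : ℝ) (ht : 0 < t) (g : ℝ → ℝ) (hg : Continuous g) :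
    ∫ w, heatK t w * g w = ∫ z, g (√t * z) ∂(gaussianReal 0 1) := by
  have h1 : (gaussianReal 0 1).map (fun z => √t * z) = gaussianReal 0 ⟨t, ht.le⟩ := by
    rw [gaussianReal_map_const_mul]
    congr 1
    · simp
    · ext; simp [Real.sq_sqrt ht.le]; rfl
  have h2 : ∫ z, g (√t * z) ∂(gaussianReal 0 1) = ∫ w, g w ∂(gaussianReal 0 ⟨t, ht.le⟩) := by
    rw [← h1, integral_map (by fun_prop) (hg.aestronglyMeasurable)]
  have hne : (⟨t, ht.le⟩ : NNReal) ≠ 0 := by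
    intro h; exact ht.ne' (congrArg NNReal.toReal h)
  rw [h2, integral_gaussianReal_eq_integral_smul hne]
  simp [heatK_eq _ _ ht]

lemma heatK_cont (t : ℝ) : Continuous (heatK t) := by
  unfold heatK; fun_prop

lemma heatK'_cont (t : ℝ) : Continuous (heatK' t) := by
  unfold heatK'; have := heatK_cont t; fun_prop

lemma heatK_hasDerivAt (t u : ℝ) (ht : 0 < t) : HasDerivAt (heatK t) (heatK' t u) u := by
  unfold heatK' heatK
  have h : HasDerivAt (fun u : ℝ => -(u ^ 2) / (2 * t)) (-(u/t)) u := by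
    have h1 : HasDerivAt (fun u : ℝ => -(u ^ 2) / (2 * t)) (-(2 * u) / (2 * t)) u := by
      simpa using ((hasDerivAt_pow 2 u).neg).div_const (2 * t)
    have h2 : -(2 * u) / (2 * t) = -(u/t) := by field_simp
    rwa [h2] at h1
  have h3 := h.exp.div_const (√(2 * π * t))
  have h4 : rexp (-(u ^ 2) / (2 * t)) * -(u / t) / √(2 * π * t)
      = -(u / t) * (rexp (-(u ^ 2) / (2 * t)) / √(2 * π * t)) := by ring
  rw [h4] at h3
  exact h3

lemma aux_shift (g : ℝ → ℝ) (k : ℝ → ℝ) (u : ℝ) :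
    ∫ v, k (u - v) * g v = ∫ w, k w * g (u - w) := by
  rw [← integral_sub_left_eq_self (fun v => k (u - v) * g v) volume u]
  simp

lemma aux_ibp (t : ℝ) (ht : 0 < t) (g : ℝ → ℝ) (hg : ContDiff ℝ 1 g) (hc : HasCompactSupport g)
    (u : ℝ) :
    ∫ v, heatK' t (u - v) * g v = ∫ z, deriv g (u - √t * z) ∂(gaussianReal 0 1) := by
  have hd : Continuous (deriv g) := hg.continuous_deriv le_rfl
  rw [aux_shift g (heatK' t), ← aux_gauss t ht (fun w => deriv g (u - w)) (by fun_prop)]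
  have hcg : HasCompactSupport (fun w => g (u - w)) :=
    hc.comp_homeomorph (Homeomorph.subLeft u)
  have hcd : HasCompactSupport (fun w => -deriv g (u - w)) :=
    (hc.deriv.comp_homeomorph (Homeomorph.subLeft u)).neg
  have hgc := hg.continuous
  have h1 := heatK_cont t
  have h2 := heatK'_cont t
  have := integral_mul_deriv_eq_deriv_mul_of_integrable (u := heatK t) (u' := heatK' t)
    (v := fun w => g (u - w)) (v' := fun w => -deriv g (u - w))
    (fun x _ => heatK_hasDerivAt t x ht)
    (fun x _ => by
      have := ((hg.differentiable one_ne_zero (u - x)).hasDerivAt).comp_const_sub u x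
      exact this)
    (Continuous.integrable_of_hasCompactSupport (by fun_prop) hcd.mul_left)
    (Continuous.integrable_of_hasCompactSupport (by fun_prop) hcg.mul_left)
    (Continuous.integrable_of_hasCompactSupport (by fun_prop) hcg.mul_left)
  simp only [mul_neg, integral_neg, neg_inj] at this
  exact this.symm

lemma aux_cs {α : Type*} [MeasurableSpace α] (m : Measure α) (f g : α → ℝ)
    (hf : MemLp f 2 m) (hg : MemLp g 2 m) :
    |∫ x, f x * g x ∂m| ≤ √(∫ x, f x ^ 2 ∂m) * √(∫ x, g x ^ 2 ∂m) := by
  have h := integral_mul_norm_le_Lp_mul_Lq (μ := m) (f := f) (g := g) (p := 2) (q := 2)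
    Real.HolderConjugate.two_two (by simpa using hf) (by simpa using hg)
  calc |∫ x, f x * g x ∂m| ≤ ∫ x, ‖f x‖ * ‖g x‖ ∂m := by
        rw [← Real.norm_eq_abs]
        refine (norm_integral_le_integral_norm _).trans (le_of_eq ?_)
        simp [norm_mul]
    _ ≤ _ := h
    _ = _ := by simp [Real.sqrt_eq_rpow]

lemma aux_cs_shift (f g : ℝ → ℝ) (hf : MemLp f 2) (hg : MemLp g 2) (c : ℝ) :
    |∫ u, f u * g (u - c)| ≤ √(∫ x, f x ^ 2) * √(∫ x, g x ^ 2) := by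
  have h := aux_cs volume f (fun u => g (u - c)) hf
    (hg.comp_measurePreserving (measurePreserving_sub_right volume c))
  rwa [integral_sub_right_eq_self (fun u => g u ^ 2) c] at h

lemma aux_ibp_f (f : SchwartzMap ℝ ℝ) (g : ℝ → ℝ) (hg : ContDiff ℝ 1 g)
    (hc : HasCompactSupport g) (c : ℝ) :
    ∫ u, f u * deriv g (u - c) = - ∫ u, deriv (fun x => f x) u * g (u - c) := by
  have hd : Continuous (deriv g) := hg.continuous_deriv le_rfl
  have hcg : HasCompactSupport (fun w => g (w - c)) :=
    hc.comp_homeomorph (Homeomorph.subRight c)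
  have hcd : HasCompactSupport (fun w => deriv g (w - c)) :=
    (hc.deriv.comp_homeomorph (Homeomorph.subRight c))
  have hgc := hg.continuous
  have hf := f.continuous
  have hfd : Continuous (deriv (fun x => f x)) := (f.smooth 1).continuous_deriv le_rfl
  exact integral_mul_deriv_eq_deriv_mul_of_integrable (u := fun x => f x)
    (u' := deriv (fun x => f x)) (v := fun w => g (w - c)) (v' := fun w => deriv g (w - c))
    (fun x _ => f.differentiable.differentiableAt.hasDerivAt)
    (fun x _ => ((hg.differentiable one_ne_zero (x - c)).hasDerivAt).comp_sub_const x c)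
    (Continuous.integrable_of_hasCompactSupport (by fun_prop) hcd.mul_left)
    (Continuous.integrable_of_hasCompactSupport (by fun_prop) hcg.mul_left)
    (Continuous.integrable_of_hasCompactSupport (by fun_prop) hcg.mul_left)

/-- Fubini on a finite parameter space. -/
lemma aux_fubini {Z : Type*} [MeasurableSpace Z] [TopologicalSpace Z] [OpensMeasurableSpace Z]
    [SecondCountableTopology Z]
    (m : Measure Z) [IsFiniteMeasure m] (f : ℝ → ℝ) (hf : Integrable f)
    (k : ℝ × Z → ℝ) (hk : Continuous k) (M : ℝ) (hM : ∀ q, |k q| ≤ M)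
    (b : Z → ℝ) (hb : Integrable b m)
    (hbound : ∀ z, |∫ u, f u * k (u, z)| ≤ b z) :
    Integrable (fun u => (∫ z, k (u, z) ∂m) * f u) ∧
    |∫ u, (∫ z, k (u, z) ∂m) * f u| ≤ ∫ z, b z ∂m := by
  have hint : Integrable (fun q : ℝ × Z => f q.1 * k q) (volume.prod m) :=
    (hf.comp_fst m).mul_bdd (c := M) hk.aestronglyMeasurable (Filter.Eventually.of_forall hM)
  have heq : (fun u => (∫ z, k (u, z) ∂m) * f u) = fun u => ∫ z, f u * k (u, z) ∂m := by
    ext u; rw [integral_const_mul, mul_comm]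
  rw [heq]
  refine ⟨hint.integral_prod_left, ?_⟩
  rw [integral_integral_swap (f := fun u z => f u * k (u, z)) hint, ← Real.norm_eq_abs]
  exact norm_integral_le_of_norm_le hb (Filter.Eventually.of_forall hbound)

theorem abs_integral_mu_mul_schwartz_le (T ρ χ : ℝ) (hT : 0 < T) (hρ : ρ ∈ Set.Ioo (0:ℝ) 1)
    (hχ : χ = ρ * (1 - ρ))
    (ψ : ℝ → ℝ) (hψ : ContDiff ℝ 2 ψ) (hψc : HasCompactSupport ψ)
    (H : ℝ → ℝ → ℝ)
    (hH1 : ∀ u, ContDiff ℝ 1 fun t => H t u)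
    (hH2 : ∀ t, ContDiff ℝ 2 fun u => H t u)
    (hHt : Continuous fun q : ℝ × ℝ => deriv (fun t => H t q.2) q.1)
    (hHu : Continuous fun q : ℝ × ℝ => deriv (H q.1) q.2)
    (hHuu : Continuous fun q : ℝ × ℝ => deriv (deriv (H q.1)) q.2)
    (hHcont : Continuous fun q : ℝ × ℝ => H q.1 q.2)
    (hHsupp : HasCompactSupport fun q : ℝ × ℝ => H q.1 q.2)
    (μ : ℝ → ℝ → ℝ)
    (hμ0 : ∀ u, μ 0 u = ψ u)
    (hμ : ∀ t ∈ Set.Ioc (0:ℝ) T, ∀ u, μ t u =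
      (∫ v, heatK t (u - v) * ψ v) -
        χ * ∫ s in (0:ℝ)..t, ∫ v, heatK' (t - s) (u - v) * deriv (H s) v) :
    ∀ f : SchwartzMap ℝ ℝ, ∀ t ∈ Set.Icc (0:ℝ) T,
      |∫ u, μ t u * f u| ≤
        Real.sqrt (∫ u, (ψ u) ^ 2) * Real.sqrt (∫ u, (f u) ^ 2) +
          χ * Real.sqrt T * Real.sqrt (∫ u, (deriv (fun x => f x) u) ^ 2) *
            Real.sqrt (∫ s in (0:ℝ)..T, ∫ u, (deriv (H s) u) ^ 2) := by
  intro f t ht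
  have hχ0 : 0 ≤ χ := by
    rw [hχ]; exact mul_nonneg hρ.1.le (by linarith [hρ.2])
  have hψL : MemLp ψ 2 := hψ.continuous.memLp_of_hasCompactSupport hψc
  have hfL : MemLp (fun x => f x) 2 := f.memLp 2
  have hfd : MemLp (deriv (fun x => f x)) 2 := by
    have := (SchwartzMap.derivCLM ℝ ℝ f).memLp 2 volume
    refine this.congr_norm ?_ (Filter.Eventually.of_forall fun x => ?_)
    · exact ((f.smooth 1).continuous_deriv le_rfl).aestronglyMeasurable
    · simp [SchwartzMap.derivCLM_apply]
  rcases ht.1.eq_or_lt with h0 | h0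
  · subst h0
    simp only [hμ0]
    refine (aux_cs volume ψ (fun x => f x) hψL hfL).trans ?_
    have : 0 ≤ χ * Real.sqrt T * Real.sqrt (∫ u, (deriv (fun x => f x) u) ^ 2) *
            Real.sqrt (∫ s in (0:ℝ)..T, ∫ u, (deriv (H s) u) ^ 2) := by positivity
    linarith
  have hGs := aux_supp H hHsupp
  have hKs := aux_supp (fun s => deriv (H s)) hGs
  have hGc : ∀ s, ContDiff ℝ 1 (deriv (H s)) := fun s =>
    (contDiff_succ_iff_deriv.mp (by rw [one_add_one_eq_two]; exact hH2 s : ContDiff ℝ (1 + 1) (H s))).2.2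
  have hGcs : ∀ s, HasCompactSupport (deriv (H s)) := aux_section (fun s => deriv (H s)) hGs
  obtain ⟨M, hM⟩ := hKs.exists_bound_of_continuous hHuu
  obtain ⟨M', hM'⟩ := hψc.exists_bound_of_continuous hψ.continuous
  have hψcont := hψ.continuous
  -- first term
  obtain ⟨i1, b1⟩ := aux_fubini (gaussianReal 0 1) (fun x => f x) f.integrable
    (fun q : ℝ × ℝ => ψ (q.1 - √t * q.2)) (by fun_prop) M' (fun q => hM' _)
    (fun _ => √(∫ u, ψ u ^ 2) * √(∫ u, f u ^ 2)) (integrable_const _)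
    (fun z => by
      rw [mul_comm (√(∫ u, ψ u ^ 2))]
      exact aux_cs_shift (fun x => f x) ψ hfL hψL (√t * z))
  simp only [integral_const, probReal_univ, one_smul] at b1
  -- the norm in space
  have hNcont : Continuous fun s => ∫ u, (deriv (H s) u) ^ 2 := by
    have hk := hGs.isCompact.image continuous_snd
    rw [← continuousOn_univ]
    refine continuousOn_integral_of_compact_support hk ?_ ?_
    · apply Continuous.continuousOn
      exact hHu.pow 2
    · intro s x _ hx
      by_contra hne
      apply hx
      refine ⟨(s, x), subset_tsupport _ ?_, rfl⟩
      intro h; apply hne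
      simp only at h
      simp [h]
  set N : ℝ → ℝ := fun s => ∫ u, (deriv (H s) u) ^ 2 with hN
  have hN0 : ∀ s, 0 ≤ N s := fun s => integral_nonneg fun u => sq_nonneg _
  set S := volume.restrict (Set.Ioo (0:ℝ) t) with hS
  have hintS : ∀ φ : ℝ → ℝ, Continuous φ → Integrable φ S := fun φ hφ =>
    (hφ.integrableOn_Icc (a := 0) (b := t)).mono_set Set.Ioo_subset_Icc_self
  set Φ := √(∫ u, (deriv (fun x => f x) u) ^ 2) with hΦ
  have hkc : Continuous (fun q : ℝ × (ℝ × ℝ) =>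
      deriv (deriv (H q.2.1)) (q.1 - √(t - q.2.1) * q.2.2)) :=
    hHuu.comp (f := fun q : ℝ × (ℝ × ℝ) => (q.2.1, q.1 - √(t - q.2.1) * q.2.2)) (by fun_prop)
  obtain ⟨i2, b2⟩ := aux_fubini (S.prod (gaussianReal 0 1)) (fun x => f x) f.integrable
    (fun q : ℝ × (ℝ × ℝ) => deriv (deriv (H q.2.1)) (q.1 - √(t - q.2.1) * q.2.2))
    hkc M (fun q => hM (q.2.1, q.1 - √(t - q.2.1) * q.2.2))
    (fun q => Φ * √(N q.1)) ((hintS (fun s => Φ * √(N s)) (by fun_prop)).comp_fst _)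
    (fun q => by
      simp only
      rw [aux_ibp_f f (deriv (H q.1)) (hGc q.1) (hGcs q.1), abs_neg]
      exact aux_cs_shift _ _ hfd
        ((hGc q.1).continuous.memLp_of_hasCompactSupport (hGcs q.1)) _)
  have e2 : ∀ u, ∫ s in (0:ℝ)..t, ∫ v, heatK' (t - s) (u - v) * deriv (H s) v
      = ∫ q, deriv (deriv (H q.1)) (u - √(t - q.1) * q.2) ∂(S.prod (gaussianReal 0 1)) := by
    intro u
    rw [intervalIntegral.integral_of_le h0.le, integral_Ioc_eq_integral_Ioo]
    rw [integral_prod]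
    · apply setIntegral_congr_fun measurableSet_Ioo
      intro s hs
      exact aux_ibp (t - s) (by linarith [hs.2]) _ (hGc s) (hGcs s) u
    · refine Integrable.of_bound (C := M) ?_
        (Filter.Eventually.of_forall fun q => hM (q.1, u - √(t - q.1) * q.2))
      apply Continuous.aestronglyMeasurable
      exact hkc.comp (f := fun q : ℝ × ℝ => (u, q)) (by fun_prop)
  have e1 : ∀ u, ∫ v, heatK t (u - v) * ψ v = ∫ z, ψ (u - √t * z) ∂(gaussianReal 0 1) := by
    intro u
    rw [aux_shift ψ (heatK t), aux_gauss t h0 (fun w => ψ (u - w)) (by fun_prop)]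
  have e3 : ∫ u, μ t u * f u = (∫ u, (∫ z, ψ (u - √t * z) ∂(gaussianReal 0 1)) * f u) -
      χ * ∫ u, (∫ q, deriv (deriv (H q.1)) (u - √(t - q.1) * q.2)
        ∂(S.prod (gaussianReal 0 1))) * f u := by
    rw [← integral_const_mul, ← integral_sub i1 (i2.const_mul χ)]
    congr 1; ext u
    rw [hμ t ⟨h0, ht.2⟩, e1, e2]; ring
  have b3 : ∫ q : ℝ × ℝ, Φ * √(N q.1) ∂(S.prod (gaussianReal 0 1)) ≤
      Φ * (√T * √(∫ s in (0:ℝ)..T, N s)) := by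
    rw [integral_fun_fst (fun s => Φ * √(N s)), probReal_univ, one_smul, integral_const_mul]
    have hc := aux_cs S (fun _ => 1) (fun s => √(N s)) (memLp_const 1)
      ((memLp_two_iff_integrable_sq (by fun_prop)).mpr (hintS _ (by fun_prop)))
    simp only [one_mul, Real.sq_sqrt (hN0 _), one_pow] at hc
    have h1 : ∫ s, (1:ℝ) ∂S = t := by simp [hS, h0.le]
    have h2 : ∫ s, N s ∂S ≤ ∫ s in (0:ℝ)..T, N s := by
      rw [intervalIntegral.integral_of_le hT.le]
      refine setIntegral_mono_set ?_ (Filter.Eventually.of_forall hN0) ?_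
      · exact (hNcont.integrableOn_Icc).mono_set Set.Ioc_subset_Icc_self
      · exact (Set.Ioo_subset_Ioc_self.trans (Set.Ioc_subset_Ioc_right ht.2)).eventuallyLE
    rw [h1] at hc
    refine mul_le_mul_of_nonneg_left ?_ (Real.sqrt_nonneg _)
    refine (le_abs_self _).trans (hc.trans ?_)
    gcongr
    exact ht.2
  rw [e3]
  have b4 := b2.trans b3
  calc _ ≤ _ := abs_sub _ _
    _ ≤ √(∫ u, ψ u ^ 2) * √(∫ u, f u ^ 2) + χ * (Φ * (√T * √(∫ s in (0:ℝ)..T, N s))) := by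
      rw [abs_mul, abs_of_nonneg hχ0]
      gcongr
    _ = _ := by ring
end

section
/- Fix T > 0 and α ∈ ℝ. Define the weight w_T : ℝ → ℝ by w_T(ξ) = ξ² e^{Tξ²/2} / (4(e^{Tξ²/2} − 1)) for ξ ≠ 0 and w_T(0) = 1/(2T). Then the infimum of ∫_ℝ w_T(ξ) g(ξ)² dξ over all measurable g : ℝ → ℝ satisfying ∫_ℝ g(ξ) dξ = √(2π) α equals √(2π) α² / (4√T), and it is attained at g(ξ) = α(1 − e^{−Tξ²/2})/(√T ξ²). -/
open Real MeasureTheory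

/-- The weight `w_T(ξ) = ξ² e^{Tξ²/2} / (4(e^{Tξ²/2} − 1))` for `ξ ≠ 0`,
extended by continuity at `ξ = 0` with value `1/(2T)`. -/
noncomputable def weightW (T ξ : ℝ) : ℝ :=
  if ξ = 0 then 1 / (2 * T)
  else ξ ^ 2 * Real.exp (T * ξ ^ 2 / 2) / (4 * (Real.exp (T * ξ ^ 2 / 2) - 1))

/-- The minimizer `g(ξ) = α(1 − e^{−Tξ²/2})/(√T ξ²)`, extended by continuity
at `ξ = 0` with value `α√T/2`. -/
noncomputable def gMin (T α ξ : ℝ) : ℝ :=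
  if ξ = 0 then α * Real.sqrt T / 2
  else α * (1 - Real.exp (-T * ξ ^ 2 / 2)) / (Real.sqrt T * ξ ^ 2)

open Set Filter Topology

noncomputable def auxG (T ξ : ℝ) : ℝ :=
  if ξ = 0 then T / 2 else (1 - Real.exp (-T * ξ ^ 2 / 2)) / ξ ^ 2

lemma auxG_mul (T ξ : ℝ) : auxG T ξ * ξ ^ 2 = 1 - Real.exp (-T * ξ ^ 2 / 2) := by
  unfold auxG
  split_ifs with h
  · simp [h]
  · field_simp

lemma auxG_nonneg (T ξ : ℝ) (hT : 0 < T) : 0 ≤ auxG T ξ := by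
  unfold auxG
  split_ifs with h
  · positivity
  · apply div_nonneg _ (sq_nonneg _)
    have : Real.exp (-T * ξ ^ 2 / 2) ≤ 1 := by
      apply Real.exp_le_one_iff.2
      nlinarith [mul_nonneg hT.le (sq_nonneg ξ)]
    linarith

lemma auxG_le (T ξ : ℝ) : auxG T ξ ≤ T / 2 := by
  unfold auxG
  split_ifs with h
  · exact le_rfl
  · have : 0 < ξ ^ 2 := by positivity
    rw [div_le_iff₀ this]
    have := Real.add_one_le_exp (-T * ξ ^ 2 / 2)
    linarith

lemma auxG_meas (T : ℝ) : Measurable (auxG T) := by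
  unfold auxG
  refine Measurable.ite (measurableSet_eq) measurable_const ?_
  fun_prop

lemma auxG_integrable (T : ℝ) (hT : 0 < T) : Integrable (auxG T) := by
  refine Integrable.mono' (integrable_inv_one_add_sq.const_mul (1 + T / 2))
    (auxG_meas T).aestronglyMeasurable (ae_of_all _ fun ξ => ?_)
  rw [Real.norm_of_nonneg (auxG_nonneg T ξ hT), ← div_eq_mul_inv, le_div_iff₀ (by positivity)]
  have h1 := auxG_mul T ξ
  have h2 := auxG_le T ξ
  have h3 := Real.exp_pos (-T * ξ ^ 2 / 2)
  nlinarith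

lemma gauss_integrable (T : ℝ) (hT : 0 < T) :
    Integrable (fun ξ : ℝ => T * Real.exp (-T * ξ ^ 2 / 2)) := by
  have := (integrable_exp_neg_mul_sq (b := T / 2) (by positivity)).const_mul T
  convert this using 4
  ring

lemma auxG_Ioi (T : ℝ) (hT : 0 < T) :
    ∫ ξ in Ioi (0:ℝ), (auxG T ξ - T * Real.exp (-T * ξ ^ 2 / 2)) = 0 := by
  have key := integral_Ioi_of_hasDerivAt_of_tendsto (a := (0:ℝ))
    (f := fun x => -(auxG T x * x)) (m := 0)
    (f' := fun ξ => auxG T ξ - T * Real.exp (-T * ξ ^ 2 / 2)) ?_ ?_ ?_ ?_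
  · rw [key]; simp
  · apply ContinuousAt.continuousWithinAt
    unfold ContinuousAt
    have h0 : Tendsto (fun x : ℝ => T / 2 * |x|) (𝓝 0) (𝓝 0) := by
      have : Continuous (fun x : ℝ => T / 2 * |x|) := by fun_prop
      simpa using this.tendsto 0
    simp only [mul_zero, neg_zero]
    refine squeeze_zero_norm (fun x => ?_) h0
    rw [norm_neg, norm_mul, Real.norm_of_nonneg (auxG_nonneg T x hT), Real.norm_eq_abs]
    exact mul_le_mul_of_nonneg_right (auxG_le T x) (abs_nonneg _)
  · intro x hx
    have hx0 : x ≠ 0 := ne_of_gt hx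
    have h1 : HasDerivAt (fun y : ℝ => -T * y ^ 2 / 2) (-T * x) x := by
      refine (((hasDerivAt_pow 2 x).const_mul (-T)).div_const 2).congr_deriv ?_
      norm_num
      ring
    have h2 := ((h1.exp.const_sub 1).div (hasDerivAt_id x) hx0).neg
    have h3 : (fun y => -(auxG T y * y)) =ᶠ[𝓝 x]
        -((fun y => 1 - Real.exp (-T * y ^ 2 / 2)) / id) := by
      filter_upwards [isOpen_ne.mem_nhds hx0] with y hy
      have hy : y ≠ 0 := hy
      simp only [auxG, hy, if_false, Pi.neg_apply, Pi.div_apply, id]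
      field_simp
    refine (h2.congr_of_eventuallyEq h3).congr_deriv ?_
    simp only [auxG, hx0, if_false, id]
    field_simp
    ring
  · exact ((auxG_integrable T hT).sub (gauss_integrable T hT)).integrableOn
  · refine squeeze_zero_norm' ?_ tendsto_inv_atTop_zero
    filter_upwards [eventually_gt_atTop 0] with x hx
    rw [norm_neg, norm_mul, Real.norm_of_nonneg (auxG_nonneg T x hT), Real.norm_of_nonneg hx.le,
      ← one_div, le_div_iff₀ hx]
    have h1 := auxG_mul T x
    have h3 := Real.exp_pos (-T * x ^ 2 / 2)
    nlinarith

lemma auxG_integral (T : ℝ) (hT : 0 < T) : ∫ ξ, auxG T ξ = T * √(2 * π / T) := by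
  have h := integral_comp_abs (f := fun ξ => auxG T ξ - T * Real.exp (-T * ξ ^ 2 / 2))
  rw [auxG_Ioi T hT] at h
  have h2 : ∀ ξ, auxG T |ξ| - T * Real.exp (-T * |ξ| ^ 2 / 2)
      = auxG T ξ - T * Real.exp (-T * ξ ^ 2 / 2) := by
    intro ξ; simp [auxG, sq_abs]
  simp only [h2] at h
  rw [integral_sub (auxG_integrable T hT) (gauss_integrable T hT), integral_const_mul] at h
  have h4 := integral_gaussian (T / 2)
  have h5 : ∀ ξ : ℝ, -(T / 2) * ξ ^ 2 = -T * ξ ^ 2 / 2 := fun ξ => by ring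
  simp only [h5] at h4
  rw [h4] at h
  have : π / (T / 2) = 2 * π / T := by field_simp
  rw [this] at h
  linarith

lemma weight_mul (T ξ : ℝ) (hT : 0 < T) : weightW T ξ * auxG T ξ = 1 / 4 := by
  unfold weightW auxG
  split_ifs with h
  · field_simp; norm_num
  · have hp : 0 < T * ξ ^ 2 / 2 := by positivity
    have h1 : Real.exp (T * ξ ^ 2 / 2) - 1 ≠ 0 := by
      have := Real.one_lt_exp_iff.2 hp
      linarith
    have h2 : Real.exp (-T * ξ ^ 2 / 2) = (Real.exp (T * ξ ^ 2 / 2))⁻¹ := by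
      rw [← Real.exp_neg]; congr 1; ring
    rw [h2]
    have h3 := Real.exp_ne_zero (T * ξ ^ 2 / 2)
    generalize Real.exp (T * ξ ^ 2 / 2) = E at *
    field_simp

lemma weight_nonneg (T ξ : ℝ) (hT : 0 < T) : 0 ≤ weightW T ξ := by
  have h1 := weight_mul T ξ hT
  have h2 := auxG_nonneg T ξ hT
  by_contra! h
  nlinarith

lemma gMin_eq (T α : ℝ) (hT : 0 < T) : gMin T α = fun ξ => α / √T * auxG T ξ := by
  funext ξ
  have hs : 0 < √T := Real.sqrt_pos.2 hT
  have h2 : √T ^ 2 = T := Real.sq_sqrt hT.le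
  unfold gMin auxG
  split_ifs with h
  · nth_rewrite 3 [← h2]
    field_simp
  · field_simp

/-- The infimum of `∫ w_T g²` over measurable `g` with `∫ g = √(2π) α` equals
`√(2π) α²/(4√T)`, and it is attained at `gMin T α`. -/
theorem weighted_variational_problem (T α : ℝ) (hT : 0 < T) :
    sInf {y : ℝ | ∃ g : ℝ → ℝ, Measurable g ∧ MeasureTheory.Integrable g ∧
        MeasureTheory.Integrable (fun ξ => weightW T ξ * (g ξ) ^ 2) ∧
        (∫ ξ, g ξ) = Real.sqrt (2 * π) * α ∧
        y = ∫ ξ, weightW T ξ * (g ξ) ^ 2} =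
      Real.sqrt (2 * π) * α ^ 2 / (4 * Real.sqrt T) ∧
    Measurable (gMin T α) ∧
    MeasureTheory.Integrable (gMin T α) ∧
    MeasureTheory.Integrable (fun ξ => weightW T ξ * (gMin T α ξ) ^ 2) ∧
    (∫ ξ, gMin T α ξ) = Real.sqrt (2 * π) * α ∧
    (∫ ξ, weightW T ξ * (gMin T α ξ) ^ 2) =
      Real.sqrt (2 * π) * α ^ 2 / (4 * Real.sqrt T) := by
  have hs : 0 < √T := Real.sqrt_pos.2 hT
  have h2 : √T ^ 2 = T := Real.sq_sqrt hT.le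
  have hI : ∫ ξ, auxG T ξ = √T * √(2 * π) := by
    rw [auxG_integral T hT, Real.sqrt_div (by positivity)]
    nth_rewrite 1 [← h2]
    field_simp
  have hG := auxG_integrable T hT
  have hwg : (fun ξ => weightW T ξ * (gMin T α ξ) ^ 2) = fun ξ => α ^ 2 / (4 * T) * auxG T ξ := by
    funext ξ
    rw [gMin_eq T α hT]
    have := weight_mul T ξ hT
    calc weightW T ξ * (α / √T * auxG T ξ) ^ 2
        = α ^ 2 / √T ^ 2 * auxG T ξ * (weightW T ξ * auxG T ξ) := by ring
      _ = _ := by rw [this, h2]; field_simp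
  have c1 : Measurable (gMin T α) := by
    rw [gMin_eq T α hT]; exact (auxG_meas T).const_mul _
  have c2 : Integrable (gMin T α) := by
    rw [gMin_eq T α hT]; exact hG.const_mul _
  have c3 : Integrable (fun ξ => weightW T ξ * (gMin T α ξ) ^ 2) := by
    rw [hwg]; exact hG.const_mul _
  have c4 : (∫ ξ, gMin T α ξ) = √(2 * π) * α := by
    rw [gMin_eq T α hT, integral_const_mul, hI]; field_simp
  have c5 : (∫ ξ, weightW T ξ * (gMin T α ξ) ^ 2) = √(2 * π) * α ^ 2 / (4 * √T) := by
    rw [hwg, integral_const_mul, hI]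
    nth_rewrite 1 [← h2]
    field_simp
  refine ⟨?_, c1, c2, c3, c4, c5⟩
  refine IsLeast.csInf_eq ⟨⟨gMin T α, c1, c2, c3, c4, c5.symm⟩, ?_⟩
  rintro y ⟨g, -, g2, g3, g4, rfl⟩
  have hle : ∫ ξ, (α / (2 * √T) * g ξ - weightW T ξ * (gMin T α ξ) ^ 2)
      ≤ ∫ ξ, weightW T ξ * (g ξ) ^ 2 := by
    refine integral_mono ((g2.const_mul _).sub c3) g3 fun ξ => ?_
    have hw := mul_nonneg (weight_nonneg T ξ hT) (sq_nonneg (g ξ - gMin T α ξ))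
    have hm : weightW T ξ * gMin T α ξ = α / (4 * √T) := by
      rw [gMin_eq T α hT]
      calc weightW T ξ * (α / √T * auxG T ξ) = α / √T * (weightW T ξ * auxG T ξ) := by ring
        _ = _ := by rw [weight_mul T ξ hT]; field_simp
    have e : α / (2 * √T) * g ξ = 2 * (weightW T ξ * gMin T α ξ) * g ξ := by
      rw [hm]; ring
    show α / (2 * √T) * g ξ - weightW T ξ * (gMin T α ξ) ^ 2 ≤ weightW T ξ * (g ξ) ^ 2
    rw [e]
    nlinarith
  rw [integral_sub (g2.const_mul _) c3, integral_const_mul, g4, c5] at hle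
  refine le_trans (le_of_eq ?_) hle
  ring
end

section
/- For every t > 0 and every s ≥ 0, (1/√(2π)) ∫_ℝ (1/(2√t ξ²)) [ 1 − e^{−tξ²/2} + e^{−|t−s|ξ²/2} − e^{−sξ²/2} ] dξ = a(t,s)/√t, where a(t,s) = (1/2)(√t + √s − √|t−s|). -/
open Real MeasureTheory

theorem gauss_half_norm (v : ℝ) (hv : 0 < v) :
    ∫ ξ : ℝ, (1 / 2) * Real.exp (-(v / 2) * ξ ^ 2) =
      (1 / 2) * (Real.sqrt (2 * π) * v ^ (-(1 / 2) : ℝ)) := by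
  rw [integral_const_mul, integral_gaussian]
  congr 1
  rw [Real.rpow_neg hv.le, ← Real.sqrt_eq_rpow, ← Real.sqrt_inv,
    ← Real.sqrt_mul (by positivity)]
  congr 1
  field_simp

theorem gauss_prod_integrable (u : ℝ) (hu : 0 ≤ u) :
    Integrable (Function.uncurry fun (ξ v : ℝ) => (1 / 2) * Real.exp (-(v / 2) * ξ ^ 2))
      ((volume : Measure ℝ).prod ((volume : Measure ℝ).restrict (Set.Ioc 0 u))) := by
  rw [integrable_prod_iff' (Continuous.aestronglyMeasurable
    (by unfold Function.uncurry; fun_prop))]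
  constructor
  · filter_upwards [ae_restrict_mem measurableSet_Ioc] with v hv
    exact (integrable_exp_neg_mul_sq (half_pos hv.1)).const_mul _
  · have h := ((intervalIntegral.intervalIntegrable_rpow' (a := 0) (b := u)
      (r := (-(1 / 2) : ℝ)) (by norm_num)).const_mul (Real.sqrt (2 * π))).const_mul (1 / 2)
    rw [intervalIntegrable_iff_integrableOn_Ioc_of_le hu] at h
    refine Integrable.congr h ?_
    filter_upwards [ae_restrict_mem measurableSet_Ioc] with v hv
    rw [← gauss_half_norm v hv.1]
    refine integral_congr_ae (Filter.Eventually.of_forall fun ξ => ?_)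
    simp only [Function.uncurry]
    rw [Real.norm_of_nonneg (by positivity)]

theorem inner_eq (u : ℝ) (hu : 0 ≤ u) (ξ : ℝ) (hξ : ξ ≠ 0) :
    ∫ v in Set.Ioc 0 u, (1 / 2) * Real.exp (-(v / 2) * ξ ^ 2) =
      (1 - Real.exp (-u * ξ ^ 2 / 2)) / ξ ^ 2 := by
  rw [← intervalIntegral.integral_of_le hu]
  have hd : ∀ v ∈ Set.uIcc 0 u, HasDerivAt (fun v : ℝ => -Real.exp (-(v / 2) * ξ ^ 2) / ξ ^ 2)
      ((1 / 2) * Real.exp (-(v / 2) * ξ ^ 2)) v := by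
    intro v _
    have h := (((((hasDerivAt_id v).div_const 2).neg.mul_const (ξ ^ 2)).exp).neg).div_const (ξ ^ 2)
    refine HasDerivAt.congr_deriv h ?_
    simp
    field_simp
  rw [intervalIntegral.integral_eq_sub_of_hasDerivAt hd
    (Continuous.intervalIntegrable (by fun_prop) _ _)]
  have : -(u / 2) * ξ ^ 2 = -u * ξ ^ 2 / 2 := by ring
  rw [this]
  simp
  ring

theorem key (u : ℝ) (hu : 0 ≤ u) :
    Integrable (fun ξ : ℝ => (1 - Real.exp (-u * ξ ^ 2 / 2)) / ξ ^ 2) ∧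
    ∫ ξ : ℝ, (1 - Real.exp (-u * ξ ^ 2 / 2)) / ξ ^ 2 = Real.sqrt (2 * π) * Real.sqrt u := by
  have hp := gauss_prod_integrable u hu
  have hae : (fun ξ : ℝ => ∫ v in Set.Ioc 0 u, (1 / 2) * Real.exp (-(v / 2) * ξ ^ 2)) =ᵐ[volume]
      fun ξ : ℝ => (1 - Real.exp (-u * ξ ^ 2 / 2)) / ξ ^ 2 := by
    filter_upwards [Measure.ae_ne volume (0 : ℝ)] with ξ hξ
    exact inner_eq u hu ξ hξ
  refine ⟨hp.integral_prod_left.congr hae, ?_⟩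
  rw [← integral_congr_ae hae, integral_integral_swap hp,
    setIntegral_congr_fun measurableSet_Ioc (fun v hv => gauss_half_norm v hv.1),
    ← intervalIntegral.integral_of_le hu, intervalIntegral.integral_const_mul,
    intervalIntegral.integral_const_mul, integral_rpow (Or.inl (by norm_num)),
    Real.sqrt_eq_rpow u]
  norm_num
  ring

/-- For every `t > 0` and `s ≥ 0`,
`(1/√(2π)) ∫ (1/(2√t ξ²)) [1 − e^{−tξ²/2} + e^{−|t−s|ξ²/2} − e^{−sξ²/2}] dξ = a(t,s)/√t`
with `a(t,s) = (1/2)(√t + √s − √|t−s|)`. -/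
theorem integral_current_covariance (t s : ℝ) (ht : 0 < t) (hs : 0 ≤ s) :
    (1 / Real.sqrt (2 * π)) *
        ∫ ξ : ℝ, (1 / (2 * Real.sqrt t * ξ ^ 2)) *
          (1 - Real.exp (-t * ξ ^ 2 / 2) + Real.exp (-|t - s| * ξ ^ 2 / 2) -
            Real.exp (-s * ξ ^ 2 / 2)) =
      ((1 / 2) * (Real.sqrt t + Real.sqrt s - Real.sqrt |t - s|)) / Real.sqrt t := by
  obtain ⟨i1, e1⟩ := key t ht.le
  obtain ⟨i2, e2⟩ := key |t - s| (abs_nonneg _)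
  obtain ⟨i3, e3⟩ := key s hs
  have hf : (fun ξ : ℝ => (1 / (2 * Real.sqrt t * ξ ^ 2)) *
          (1 - Real.exp (-t * ξ ^ 2 / 2) + Real.exp (-|t - s| * ξ ^ 2 / 2) -
            Real.exp (-s * ξ ^ 2 / 2))) = fun ξ : ℝ => (1 / (2 * Real.sqrt t)) *
      ((1 - Real.exp (-t * ξ ^ 2 / 2)) / ξ ^ 2 + (1 - Real.exp (-s * ξ ^ 2 / 2)) / ξ ^ 2
        - (1 - Real.exp (-|t - s| * ξ ^ 2 / 2)) / ξ ^ 2) := by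
    funext ξ
    rw [one_div, mul_inv, one_div]
    ring
  have i13 : Integrable (fun ξ : ℝ => (1 - Real.exp (-t * ξ ^ 2 / 2)) / ξ ^ 2 +
      (1 - Real.exp (-s * ξ ^ 2 / 2)) / ξ ^ 2) := i1.add i3
  rw [hf, integral_const_mul, integral_sub i13 i2, integral_add i1 i3, e1, e2, e3]
  have h1 : Real.sqrt (2 * π) ≠ 0 := by positivity
  have h2 : Real.sqrt t ≠ 0 := by positivity
  field_simp
end

section
/- For all real numbers 0 < t₁ ≤ t₂, (1/(32√(t₁t₂))) ∫₀^{t₁} ∫_ℝ { [e^{−(t₁−s)ξ²/2} + e^{−sξ²/2}][e^{−(t₂−s)ξ²/2} + e^{−sξ²/2}] + [e^{−(t₁−s)ξ²/2} − e^{−sξ²/2}][e^{−(t₂−s)ξ²/2} − e^{−sξ²/2}] } dξ ds = (√π/(8√(t₁t₂))) ( √((t₁+t₂)/2) − √((t₂−t₁)/2) + √t₁ ). -/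
open Real MeasureTheory

lemma aux_eq {x : ℝ} (hx : 0 ≤ x) : √(π / x) = √π * x ^ (-(1/2) : ℝ) := by
  rw [Real.sqrt_div pi_pos.le, Real.rpow_neg hx, ← Real.sqrt_eq_rpow, div_eq_mul_inv]

lemma aux_ii {a b : ℝ} (ha : 0 ≤ a) (hab : a ≤ b) :
    IntervalIntegrable (fun x : ℝ => √(π / x)) volume a b := by
  have h : IntervalIntegrable (fun x : ℝ => √π * x ^ (-(1/2) : ℝ)) volume a b :=
    (intervalIntegral.intervalIntegrable_rpow' (by norm_num)).const_mul _
  refine h.congr ?_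
  intro x hx
  rw [Set.uIoc_of_le hab] at hx
  exact (aux_eq (ha.trans hx.1.le)).symm

lemma aux_int {a b : ℝ} (ha : 0 ≤ a) (hab : a ≤ b) :
    ∫ x in a..b, √(π / x) = 2 * √π * (√b - √a) := by
  have h : ∫ x in a..b, √(π / x) = ∫ x in a..b, √π * x ^ (-(1/2) : ℝ) := by
    apply intervalIntegral.integral_congr
    intro x hx
    rw [Set.uIcc_of_le hab] at hx
    exact aux_eq (ha.trans hx.1)
  rw [h, intervalIntegral.integral_const_mul, integral_rpow (Or.inl (by norm_num)),
    Real.sqrt_eq_rpow b, Real.sqrt_eq_rpow a]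
  norm_num
  ring

lemma aux_inner (t₁ t₂ s : ℝ) (h12 : t₁ ≤ t₂) (hs : 0 < s) (hs1 : s < t₁) :
    (∫ ξ : ℝ,
          ((Real.exp (-(t₁ - s) * ξ ^ 2 / 2) + Real.exp (-s * ξ ^ 2 / 2)) *
              (Real.exp (-(t₂ - s) * ξ ^ 2 / 2) + Real.exp (-s * ξ ^ 2 / 2)) +
            (Real.exp (-(t₁ - s) * ξ ^ 2 / 2) - Real.exp (-s * ξ ^ 2 / 2)) *
              (Real.exp (-(t₂ - s) * ξ ^ 2 / 2) - Real.exp (-s * ξ ^ 2 / 2)))) =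
      2 * (√(π / ((t₁ + t₂) / 2 - s)) + √(π / s)) := by
  rw [← integral_gaussian, ← integral_gaussian, ← integral_add
    (integrable_exp_neg_mul_sq (by linarith)) (integrable_exp_neg_mul_sq hs),
    ← integral_const_mul]
  congr 1
  ext ξ
  have e1 : Real.exp (-((t₁ + t₂) / 2 - s) * ξ ^ 2) =
      Real.exp (-(t₁ - s) * ξ ^ 2 / 2) * Real.exp (-(t₂ - s) * ξ ^ 2 / 2) := by
    rw [← Real.exp_add]; congr 1; ring
  have e2 : Real.exp (-s * ξ ^ 2) =
      Real.exp (-s * ξ ^ 2 / 2) * Real.exp (-s * ξ ^ 2 / 2) := by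
    rw [← Real.exp_add]; congr 1; ring
  rw [e1, e2]
  ring

/-- For `0 < t₁ ≤ t₂`, the double integral over `[0,t₁] × ℝ` identity from the
computation of the cross term `A(0,t₁)` of the finite-dimensional rate function. -/
theorem integral_A_zero_t1 (t₁ t₂ : ℝ) (h1 : 0 < t₁) (h12 : t₁ ≤ t₂) :
    (1 / (32 * Real.sqrt (t₁ * t₂))) *
        ∫ s in (0:ℝ)..t₁, ∫ ξ : ℝ,
          ((Real.exp (-(t₁ - s) * ξ ^ 2 / 2) + Real.exp (-s * ξ ^ 2 / 2)) *
              (Real.exp (-(t₂ - s) * ξ ^ 2 / 2) + Real.exp (-s * ξ ^ 2 / 2)) +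
            (Real.exp (-(t₁ - s) * ξ ^ 2 / 2) - Real.exp (-s * ξ ^ 2 / 2)) *
              (Real.exp (-(t₂ - s) * ξ ^ 2 / 2) - Real.exp (-s * ξ ^ 2 / 2))) =
      (Real.sqrt π / (8 * Real.sqrt (t₁ * t₂))) *
        (Real.sqrt ((t₁ + t₂) / 2) - Real.sqrt ((t₂ - t₁) / 2) + Real.sqrt t₁) := by
  have hin : (∫ s in (0:ℝ)..t₁, ∫ ξ : ℝ,
          ((Real.exp (-(t₁ - s) * ξ ^ 2 / 2) + Real.exp (-s * ξ ^ 2 / 2)) *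
              (Real.exp (-(t₂ - s) * ξ ^ 2 / 2) + Real.exp (-s * ξ ^ 2 / 2)) +
            (Real.exp (-(t₁ - s) * ξ ^ 2 / 2) - Real.exp (-s * ξ ^ 2 / 2)) *
              (Real.exp (-(t₂ - s) * ξ ^ 2 / 2) - Real.exp (-s * ξ ^ 2 / 2)))) =
      ∫ s in (0:ℝ)..t₁, 2 * (√(π / ((t₁ + t₂) / 2 - s)) + √(π / s)) := by
    apply intervalIntegral.integral_congr_ae
    have hne : ∀ᵐ s : ℝ, s ≠ t₁ := by simp [ae_iff]
    filter_upwards [hne] with s hs hs'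
    rw [Set.uIoc_of_le h1.le] at hs'
    exact aux_inner t₁ t₂ s h12 hs'.1 (lt_of_le_of_ne hs'.2 hs)
  have hi1 : IntervalIntegrable (fun s : ℝ => √(π / ((t₁ + t₂) / 2 - s))) volume 0 t₁ := by
    have h := (aux_ii (a := (t₁ + t₂) / 2 - t₁) (b := (t₁ + t₂) / 2)
      (by linarith) (by linarith)).comp_sub_left ((t₁ + t₂) / 2)
    simpa using h.symm
  rw [hin, intervalIntegral.integral_const_mul,
    intervalIntegral.integral_add hi1 (aux_ii le_rfl h1.le),
    intervalIntegral.integral_comp_sub_left (fun x => √(π / x)),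
    aux_int (by linarith) (by linarith), aux_int le_rfl h1.le,
    show (t₁ + t₂) / 2 - t₁ = (t₂ - t₁) / 2 by ring]
  simp only [sub_zero, Real.sqrt_zero]
  have : √(t₁ * t₂) ≠ 0 := (Real.sqrt_pos.2 (mul_pos h1 (h1.trans_le h12))).ne'
  field_simp
  ring
end

section
/- For all real numbers 0 < t₁ ≤ t₂ ≤ T, (1/(16√(t₁t₂))) ∫_ℝ ξ^{−2} { (1 − e^{−t₁ξ²/2})(1 − e^{−t₂ξ²/2}) + (e^{−(T−t₁)ξ²/2} − e^{−Tξ²/2})(e^{−(T−t₂)ξ²/2} − e^{−Tξ²/2}) } dξ = (√π/(8√(t₁t₂))) { √(t₁/2) + √(t₂/2) − √((t₁+t₂)/2) − √(T − (t₁+t₂)/2) − √T + √(T − t₂/2) + √(T − t₁/2) }. -/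
open Real MeasureTheory

lemma aux_bd (a x : ℝ) : 1 - Real.exp (-a * x ^ 2) ≤ a * x ^ 2 := by
  have := Real.add_one_le_exp (-a * x ^ 2)
  linarith

lemma aux_nn (a x : ℝ) (ha : 0 ≤ a) : 0 ≤ 1 - Real.exp (-a * x ^ 2) := by
  have : Real.exp (-a * x ^ 2) ≤ 1 := by
    apply Real.exp_le_one_iff.2
    nlinarith [mul_nonneg ha (sq_nonneg x)]
  linarith

lemma aux_int_s15 (a : ℝ) (ha : 0 ≤ a) :
    Integrable (fun x : ℝ => (x ^ 2)⁻¹ * (1 - Real.exp (-a * x ^ 2))) := by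
  refine Integrable.mono' (integrable_inv_one_add_sq.const_mul (a + 1)) ?_ ?_
  · apply Measurable.aestronglyMeasurable
    fun_prop
  · refine Filter.Eventually.of_forall fun x => ?_
    have h0 := aux_nn a x ha
    have h1 := aux_bd a x
    have h2 : 0 ≤ (x ^ 2)⁻¹ := by positivity
    rw [Real.norm_of_nonneg (mul_nonneg h2 h0)]
    rcases eq_or_ne x 0 with rfl | hx
    · simp; linarith
    · have hx2 : 0 < x ^ 2 := by positivity
      have h3 := Real.exp_pos (-a * x ^ 2)
      rw [inv_mul_eq_div, ← div_eq_mul_inv, div_le_div_iff₀ hx2 (by positivity)]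
      nlinarith

lemma aux_val (a : ℝ) (ha : 0 ≤ a) :
    ∫ x : ℝ, (x ^ 2)⁻¹ * (1 - Real.exp (-a * x ^ 2)) = 2 * (Real.sqrt π * Real.sqrt a) := by
  rcases ha.eq_or_lt with rfl | hpos
  · simp
  have e1 := integral_comp_abs (f := fun x : ℝ => (x ^ 2)⁻¹ * (1 - Real.exp (-a * x ^ 2)))
  simp only [sq_abs] at e1
  rw [e1]
  have hi1 := (aux_int_s15 a ha).integrableOn (s := Set.Ioi 0)
  have hi2 := ((integrable_exp_neg_mul_sq hpos).const_mul (2 * a)).integrableOn (s := Set.Ioi 0)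
  have key := integral_Ioi_of_hasDerivAt_of_tendsto (a := (0 : ℝ)) (m := 0)
    (f := fun x : ℝ => -(x⁻¹ * (1 - Real.exp (-a * x ^ 2))))
    (f' := fun x => (x ^ 2)⁻¹ * (1 - Real.exp (-a * x ^ 2)) - 2 * a * Real.exp (-a * x ^ 2))
    ?_ ?_ (hi1.sub hi2) ?_
  · rw [integral_sub hi1 hi2, integral_const_mul, integral_gaussian_Ioi] at key
    simp only [inv_zero, zero_mul, neg_zero, sub_zero] at key
    have : a * √(π / a) = √π * √a := by
      rw [Real.sqrt_div pi_pos.le]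
      have := Real.mul_self_sqrt ha
      have : √a ≠ 0 := by positivity
      field_simp
      nlinarith
    linarith
  · apply ContinuousAt.continuousWithinAt
    rw [ContinuousAt]
    simp only [inv_zero, zero_mul, neg_zero]
    refine squeeze_zero_norm (a := fun x => a * |x|) (fun x => ?_) ?_
    · rw [norm_neg, norm_mul, norm_inv, Real.norm_of_nonneg (aux_nn a x ha), Real.norm_eq_abs]
      rcases eq_or_ne x 0 with rfl | hx
      · simp
      · have : 0 < |x| := by positivity
        rw [inv_mul_le_iff₀ this]
        have := aux_bd a x
        have := sq_abs x
        nlinarith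
    · have : Continuous fun x : ℝ => a * |x| := by fun_prop
      simpa using this.tendsto 0
  · intro x hx
    have hx : x ≠ 0 := ne_of_gt hx
    have h := ((hasDerivAt_inv hx).mul
      ((((hasDerivAt_pow 2 x).const_mul (-a)).exp).const_sub 1)).neg
    refine h.congr_deriv ?_
    field_simp
    ring
  · refine squeeze_zero_norm' (a := fun x => x⁻¹) ?_ tendsto_inv_atTop_zero
    filter_upwards [Filter.eventually_gt_atTop 0] with x hx
    rw [norm_neg, norm_mul, norm_inv, Real.norm_of_nonneg (aux_nn a x ha), Real.norm_of_nonneg hx.le]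
    have := Real.exp_pos (-a * x ^ 2)
    have : 0 < x⁻¹ := by positivity
    nlinarith

/-- For `0 < t₁ ≤ t₂ ≤ T`, the integral identity giving the boundary terms of the
finite-dimensional rate function. -/
theorem integral_boundary_terms (t₁ t₂ T : ℝ) (h1 : 0 < t₁) (h12 : t₁ ≤ t₂) (h2T : t₂ ≤ T) :
    (1 / (16 * Real.sqrt (t₁ * t₂))) *
        ∫ ξ : ℝ, (ξ ^ 2)⁻¹ *
          ((1 - Real.exp (-t₁ * ξ ^ 2 / 2)) * (1 - Real.exp (-t₂ * ξ ^ 2 / 2)) +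
            (Real.exp (-(T - t₁) * ξ ^ 2 / 2) - Real.exp (-T * ξ ^ 2 / 2)) *
              (Real.exp (-(T - t₂) * ξ ^ 2 / 2) - Real.exp (-T * ξ ^ 2 / 2))) =
      (Real.sqrt π / (8 * Real.sqrt (t₁ * t₂))) *
        (Real.sqrt (t₁ / 2) + Real.sqrt (t₂ / 2) - Real.sqrt ((t₁ + t₂) / 2) -
          Real.sqrt (T - (t₁ + t₂) / 2) - Real.sqrt T + Real.sqrt (T - t₂ / 2) +
          Real.sqrt (T - t₁ / 2)) := by
  have p1 : 0 ≤ t₁ / 2 := by linarith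
  have p2 : 0 ≤ t₂ / 2 := by linarith
  have p3 : 0 ≤ (t₁ + t₂) / 2 := by linarith
  have p4 : 0 ≤ T - (t₁ + t₂) / 2 := by linarith
  have p5 : 0 ≤ T := by linarith
  have p6 : 0 ≤ T - t₂ / 2 := by linarith
  have p7 : 0 ≤ T - t₁ / 2 := by linarith
  let g : ℝ → ℝ → ℝ := fun a x => (x ^ 2)⁻¹ * (1 - Real.exp (-a * x ^ 2))
  have gi : ∀ a, 0 ≤ a → Integrable (g a) := aux_int_s15
  have gv : ∀ a, 0 ≤ a → ∫ x, g a x = 2 * (Real.sqrt π * Real.sqrt a) := aux_val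
  have e : (fun ξ : ℝ => (ξ ^ 2)⁻¹ *
          ((1 - Real.exp (-t₁ * ξ ^ 2 / 2)) * (1 - Real.exp (-t₂ * ξ ^ 2 / 2)) +
            (Real.exp (-(T - t₁) * ξ ^ 2 / 2) - Real.exp (-T * ξ ^ 2 / 2)) *
              (Real.exp (-(T - t₂) * ξ ^ 2 / 2) - Real.exp (-T * ξ ^ 2 / 2)))) =
      g (t₁ / 2) + g (t₂ / 2) - g ((t₁ + t₂) / 2) - g (T - (t₁ + t₂) / 2) - g T
        + g (T - t₂ / 2) + g (T - t₁ / 2) := by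
    funext x
    simp only [g, Pi.add_apply, Pi.sub_apply]
    have q1 : Real.exp (-(t₁ / 2) * x ^ 2) = Real.exp (-t₁ * x ^ 2 / 2) := by ring_nf
    have q2 : Real.exp (-(t₂ / 2) * x ^ 2) = Real.exp (-t₂ * x ^ 2 / 2) := by ring_nf
    have q3 : Real.exp (-((t₁ + t₂) / 2) * x ^ 2)
        = Real.exp (-t₁ * x ^ 2 / 2) * Real.exp (-t₂ * x ^ 2 / 2) := by
      rw [← Real.exp_add]; ring_nf
    have q4 : Real.exp (-(T - (t₁ + t₂) / 2) * x ^ 2)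
        = Real.exp (-(T - t₁) * x ^ 2 / 2) * Real.exp (-(T - t₂) * x ^ 2 / 2) := by
      rw [← Real.exp_add]; ring_nf
    have q5 : Real.exp (-T * x ^ 2)
        = Real.exp (-T * x ^ 2 / 2) * Real.exp (-T * x ^ 2 / 2) := by
      rw [← Real.exp_add]; ring_nf
    have q6 : Real.exp (-(T - t₂ / 2) * x ^ 2)
        = Real.exp (-T * x ^ 2 / 2) * Real.exp (-(T - t₂) * x ^ 2 / 2) := by
      rw [← Real.exp_add]; ring_nf
    have q7 : Real.exp (-(T - t₁ / 2) * x ^ 2)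
        = Real.exp (-(T - t₁) * x ^ 2 / 2) * Real.exp (-T * x ^ 2 / 2) := by
      rw [← Real.exp_add]; ring_nf
    rw [q1, q2, q3, q4, q5, q6, q7]
    ring
  have i2 := (gi _ p1).add (gi _ p2)
  have i3 := i2.sub (gi _ p3)
  have i4 := i3.sub (gi _ p4)
  have i5 := i4.sub (gi _ p5)
  have i6 := i5.add (gi _ p6)
  rw [e, integral_add' i6 (gi _ p7), integral_add' i5 (gi _ p6), integral_sub' i4 (gi _ p5),
    integral_sub' i3 (gi _ p4), integral_sub' i2 (gi _ p3), integral_add' (gi _ p1) (gi _ p2),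
    gv _ p1, gv _ p2, gv _ p3, gv _ p4, gv _ p5, gv _ p6, gv _ p7]
  ring
end
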